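/- arXiv:2312.11616 — 2 statements merged into one kernel-verified Lean document; each statement's English description precedes it below -/
import Mathlib

section
/- For every τ ∈ ℍ, the identity F(τ,ρ) − F_D(τ,ρ) = θ₃(τ)² θ₃(τ,ρ)/(2 θ₂(τ,ρ) θ₄(τ,ρ)) holds as an identity of meromorphic functions of ρ ∈ ℂ, where F(τ,ρ) = −(w^{1/2}/θ₄(τ)) ∑_{n∈ℤ} (−1)ⁿ q^{n²/2 − 1/8}/(1 − w q^{n−1/2}) and F_D(τ,ρ) = −(w^{1/2}/θ₂(τ)) ∑_{n∈ℤ} q^{n(n+1)/2}/(1 + w qⁿ), with w = e^{2πiρ}. -/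
open Complex

noncomputable section

/-- `e^{2πiτs}`, i.e. `q^s` for `q = e^{2πiτ}`. -/
def qp (τ s : ℂ) : ℂ := Complex.exp (2 * (Real.pi : ℂ) * Complex.I * τ * s)

/-- Jacobi theta function `θ₂(τ,v) = ∑_{r∈ℤ+1/2} q^{r²/2} e^{2πirv}`. -/
def theta2e (τ v : ℂ) : ℂ :=
  ∑' n : ℤ, qp τ (((n : ℂ) + 1 / 2) ^ 2 / 2) *
    Complex.exp (2 * (Real.pi : ℂ) * Complex.I * ((n : ℂ) + 1 / 2) * v)

/-- Jacobi theta function `θ₃(τ,v) = ∑_{n∈ℤ} q^{n²/2} e^{2πinv}`. -/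
def theta3e (τ v : ℂ) : ℂ :=
  ∑' n : ℤ, qp τ ((n : ℂ) ^ 2 / 2) *
    Complex.exp (2 * (Real.pi : ℂ) * Complex.I * (n : ℂ) * v)

/-- Jacobi theta function `θ₄(τ,v) = ∑_{n∈ℤ} (−1)ⁿ q^{n²/2} e^{2πinv}`. -/
def theta4e (τ v : ℂ) : ℂ :=
  ∑' n : ℤ, (-1 : ℂ) ^ n * qp τ ((n : ℂ) ^ 2 / 2) *
    Complex.exp (2 * (Real.pi : ℂ) * Complex.I * (n : ℂ) * v)

/-- Theta constant `θ₂(τ) = θ₂(τ,0)`. -/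
def theta2 (τ : ℂ) : ℂ := theta2e τ 0

/-- Theta constant `θ₃(τ) = θ₃(τ,0)`. -/
def theta3 (τ : ℂ) : ℂ := theta3e τ 0

/-- Theta constant `θ₄(τ) = θ₄(τ,0)`. -/
def theta4 (τ : ℂ) : ℂ := theta4e τ 0

/-- The mock Jacobi form
`F(τ,ρ) = −(w^{1/2}/θ₄(τ)) ∑_{n∈ℤ} (−1)ⁿ q^{n²/2−1/8}/(1 − w q^{n−1/2})`, `w = e^{2πiρ}`. -/
def Fe (τ ρ : ℂ) : ℂ :=
  -(Complex.exp ((Real.pi : ℂ) * Complex.I * ρ) / theta4 τ) *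
    ∑' n : ℤ, (-1 : ℂ) ^ n * qp τ ((n : ℂ) ^ 2 / 2 - 1 / 8) /
      (1 - Complex.exp (2 * (Real.pi : ℂ) * Complex.I * ρ) * qp τ ((n : ℂ) - 1 / 2))

/-- The dual function
`F_D(τ,ρ) = −(w^{1/2}/θ₂(τ)) ∑_{n∈ℤ} q^{n(n+1)/2}/(1 + w qⁿ)`, `w = e^{2πiρ}`. -/
def FD (τ ρ : ℂ) : ℂ :=
  -(Complex.exp ((Real.pi : ℂ) * Complex.I * ρ) / theta2 τ) *
    ∑' n : ℤ, qp τ ((n : ℂ) * ((n : ℂ) + 1) / 2) /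
      (1 + Complex.exp (2 * (Real.pi : ℂ) * Complex.I * ρ) * qp τ (n : ℂ))


open Filter Topology

/-- The infinite product `∏ (1 + q^k x)`. -/
def EP (q x : ℂ) : ℂ := ∏' k : ℕ, (1 + q ^ k * x)

lemma EP_summable {q : ℂ} (hq : ‖q‖ < 1) (x : ℂ) : Summable fun k : ℕ => ‖q ^ k * x‖ := by
  simp only [norm_mul, norm_pow]
  exact (summable_geometric_of_lt_one (norm_nonneg _) hq).mul_right _

lemma EP_tendsto {q : ℂ} (hq : ‖q‖ < 1) (x : ℂ) :
    Tendsto (fun m => ∏ k ∈ Finset.range m, (1 + q ^ k * x)) atTop (𝓝 (EP q x)) :=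
  (multipliable_one_add_of_summable (EP_summable hq x)).hasProd.tendsto_prod_nat

lemma EP_ne_zero {q : ℂ} (hq : ‖q‖ < 1) (x : ℂ) (h : ∀ k : ℕ, 1 + q ^ k * x ≠ 0) :
    EP q x ≠ 0 :=
  tprod_one_add_ne_zero_of_summable h (EP_summable hq x)

lemma EP_eq_zero {q : ℂ} (x : ℂ) (k : ℕ) (h : 1 + q ^ k * x = 0) :
    EP q x = 0 := tprod_of_exists_eq_zero ⟨k, h⟩

lemma EP_rec {q : ℂ} (hq : ‖q‖ < 1) (x : ℂ) : EP q x = (1 + x) * EP q (q * x) := by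
  refine tendsto_nhds_unique ((EP_tendsto hq x).comp (tendsto_add_atTop_nat 1)) ?_
  refine ((EP_tendsto hq (q * x)).const_mul (1 + x)).congr fun m => ?_
  simp only [Function.comp, Finset.prod_range_succ']
  rw [mul_comm]
  congr 1
  · exact Finset.prod_congr rfl fun k _ => by ring
  · simp

lemma EP_continuous {q : ℂ} (hq : ‖q‖ < 1) : Continuous (EP q) := by
  rw [continuous_iff_continuousAt]
  intro x
  have hu : Summable fun k : ℕ => ‖q‖ ^ k * (‖x‖ + 1) :=
    (summable_geometric_of_lt_one (norm_nonneg _) hq).mul_right _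
  have h := hu.hasProdLocallyUniformlyOn_nat_one_add (f := fun k (y : ℂ) => q ^ k * y)
    (Metric.isOpen_ball (x := x) (ε := 1)) (Eventually.of_forall fun k y hy => by
      rw [norm_mul, norm_pow]
      gcongr
      have := norm_sub_norm_le y x
      rw [mem_ball_iff_norm] at hy
      linarith) (fun k => by fun_prop)
  have h2 := h.continuousOn (Frequently.of_forall fun s => by fun_prop)
  exact h2.continuousAt (Metric.ball_mem_nhds x one_pos)

/-- `(q;q)_n` -/
def qfac (q : ℂ) (n : ℕ) : ℂ := ∏ k ∈ Finset.range n, (1 + q ^ k * (-q))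

lemma qfac_succ (q : ℂ) (n : ℕ) : qfac q (n + 1) = qfac q n * (1 - q ^ (n + 1)) := by
  rw [qfac, Finset.prod_range_succ, qfac]; ring

lemma one_sub_pow_ne {q : ℂ} (hq : ‖q‖ < 1) (n : ℕ) : 1 - q ^ (n + 1) ≠ 0 := by
  intro h
  have h1 : q ^ (n + 1) = 1 := (sub_eq_zero.mp h).symm
  have h2 : ‖q‖ ^ (n + 1) = 1 := by rw [← norm_pow, h1, norm_one]
  have := pow_lt_one₀ (norm_nonneg q) hq (Nat.succ_ne_zero n)
  exact absurd h2 this.ne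

lemma qfac_ne {q : ℂ} (hq : ‖q‖ < 1) (n : ℕ) : qfac q n ≠ 0 := by
  induction n with
  | zero => simp [qfac]
  | succ n ih => rw [qfac_succ]; exact mul_ne_zero ih (one_sub_pow_ne hq n)

lemma qinf_ne {q : ℂ} (hq : ‖q‖ < 1) : EP q (-q) ≠ 0 :=
  EP_ne_zero hq _ fun k => by
    have := one_sub_pow_ne hq k
    rw [pow_succ] at this
    rwa [mul_neg, ← sub_eq_add_neg]

/-- `1/(q;q)_k`, zero for negative `k`. -/
def rq (q : ℂ) (k : ℤ) : ℂ := if 0 ≤ k then (qfac q k.toNat)⁻¹ else 0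

lemma rq_rec {q : ℂ} (hq : ‖q‖ < 1) (k : ℤ) : rq q k = (1 - q ^ (k + 1)) * rq q (k + 1) := by
  rcases lt_trichotomy k (-1) with h | h | h
  · rw [rq, rq, if_neg (by omega), if_neg (by omega), mul_zero]
  · subst h; simp [rq]
  · lift k to ℕ using (by omega)
    rw [rq, rq, if_pos (by omega), if_pos (by omega)]
    have : ((k : ℤ) + 1).toNat = k + 1 := by omega
    rw [this, qfac_succ, Int.toNat_natCast]
    have h1 := one_sub_pow_ne hq k
    have h2 := qfac_ne hq k
    have h3 : q ^ ((k : ℤ) + 1) = q ^ (k + 1) := by norm_cast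
    rw [h3]
    field_simp

lemma finite_jtp {q z : ℂ} (hq : ‖q‖ < 1) (hq0 : q ≠ 0) (hz : z ≠ 0) (t : ℤ → ℂ)
    (t0 : t 0 = 1) (ht : ∀ j, t (j + 1) = t j * q ^ j * z) (m : ℕ) :
    HasSum (fun j : ℤ => qfac q (2 * m) * rq q (m + j) * rq q (m - j) * t j)
      (∏ k ∈ Finset.range m, ((1 + q ^ k * z) * (1 + q ^ k * (q / z)))) := by
  induction m with
  | zero =>
    have := hasSum_single (f := fun j : ℤ => qfac q (2 * 0) * rq q ((0 : ℕ) + j) *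
      rq q ((0 : ℕ) - j) * t j) 0 (by
        intro j hj
        rcases lt_or_gt_of_ne hj with h | h
        · have : rq q ((0 : ℕ) + j) = 0 := by rw [rq, if_neg]; push_cast; omega
          simp only [this]; ring
        · have : rq q ((0 : ℕ) - j) = 0 := by rw [rq, if_neg]; push_cast; omega
          simp only [this]; ring)
    simpa [rq, qfac, t0] using this
  | succ m ih =>
    have e1 := (Equiv.subRight (1 : ℤ)).hasSum_iff.mpr ih
    have e2 := (Equiv.addRight (1 : ℤ)).hasSum_iff.mpr ih
    have e := ((ih.mul_left (1 + q ^ (2 * m + 1))).add (e1.mul_left (q ^ m * z))).add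
      (e2.mul_left (q ^ (m + 1) / z))
    rw [Finset.prod_range_succ]
    refine (congrArg₂ (fun f s => HasSum f s) ?_ ?_).mpr e
    · funext j
      simp only [Function.comp, Equiv.subRight_apply, Equiv.coe_addRight]
      have a1 : rq q (m + j) = (1 - q ^ ((m : ℤ) + j + 1)) * rq q (m + j + 1) := rq_rec hq _
      have a2 : rq q (m - j) = (1 - q ^ ((m : ℤ) - j + 1)) * rq q (m - j + 1) := rq_rec hq _
      have a3 : rq q (m + (j - 1)) = (1 - q ^ ((m : ℤ) + j)) * rq q (m + j) := by
        rw [rq_rec hq]; ring_nf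
      have a4 : rq q (m - (j + 1)) = (1 - q ^ ((m : ℤ) - j)) * rq q (m - j) := by
        rw [rq_rec hq]; ring_nf
      have a5 : (m : ℤ) - (j - 1) = m - j + 1 := by ring
      have a6 : (m : ℤ) + (j + 1) = m + j + 1 := by ring
      have b1 := ht j
      have b2 := ht (j - 1)
      rw [sub_add_cancel] at b2
      have hX : q ^ (j - 1) = q ^ j / q := by rw [zpow_sub₀ hq0, zpow_one]
      have hJ : q ^ j ≠ 0 := zpow_ne_zero _ hq0
      have b3 : t (j - 1) = t j * q / (q ^ j * z) := by
        rw [b2, hX]; field_simp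
      rw [b1, b3, a5, a6, a3, a4, a1, a2]
      have c1 : ((m + 1 : ℕ) : ℤ) + j = m + j + 1 := by push_cast; ring
      have c2 : ((m + 1 : ℕ) : ℤ) - j = m - j + 1 := by push_cast; ring
      have c3 : 2 * (m + 1) = 2 * m + 1 + 1 := by ring
      rw [c1, c2, c3, qfac_succ, qfac_succ]
      simp only [zpow_add₀ hq0, zpow_sub₀ hq0, zpow_natCast, zpow_one]
      generalize rq q (m + j + 1) = R
      generalize rq q (m - j + 1) = S
      rw [show q ^ (2 * m + 1 + 1) = q ^ m * q ^ m * q * q by ring,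
        show q ^ (2 * m + 1) = q ^ m * q ^ m * q by ring, pow_succ]
      generalize q ^ m = M
      generalize q ^ j = J at *
      field_simp
      ring
    · generalize ∏ k ∈ Finset.range m, ((1 + q ^ k * z) * (1 + q ^ k * (q / z))) = P
      rw [show q ^ (2 * m + 1) = q ^ m * q ^ m * q by ring, pow_succ]
      field_simp
      ring

lemma qfac_tendsto {q : ℂ} (hq : ‖q‖ < 1) : Tendsto (qfac q) atTop (𝓝 (EP q (-q))) :=
  EP_tendsto hq (-q)

lemma rq_tendsto {q : ℂ} (hq : ‖q‖ < 1) : Tendsto (rq q) atTop (𝓝 (EP q (-q))⁻¹) := by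
  have h : Tendsto (fun k : ℤ => k.toNat) atTop atTop :=
    tendsto_atTop.mpr fun n => (eventually_ge_atTop (n : ℤ)).mono fun k hk => by omega
  refine (((qfac_tendsto hq).comp h).inv₀ (qinf_ne hq)).congr' ?_
  filter_upwards [eventually_ge_atTop 0] with k hk
  simp [rq, hk]

lemma rq_bdd {q : ℂ} (hq : ‖q‖ < 1) : ∃ C : ℝ, 0 ≤ C ∧ ∀ k, ‖rq q k‖ ≤ C := by
  have h := ((qfac_tendsto hq).inv₀ (qinf_ne hq)).norm.bddAbove_range
  obtain ⟨C, hC⟩ := h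
  have hC' : ∀ n, ‖(qfac q n)⁻¹‖ ≤ C := fun n => hC ⟨n, rfl⟩
  refine ⟨C, (norm_nonneg _).trans (hC' 0), fun k => ?_⟩
  rw [rq]
  split_ifs
  · exact hC' _
  · simpa using (norm_nonneg _).trans (hC' 0)

lemma qfac_bdd {q : ℂ} (hq : ‖q‖ < 1) : ∃ C : ℝ, 0 ≤ C ∧ ∀ k, ‖qfac q k‖ ≤ C := by
  obtain ⟨C, hC⟩ := (qfac_tendsto hq).norm.bddAbove_range
  have hC' : ∀ n, ‖qfac q n‖ ≤ C := fun n => hC ⟨n, rfl⟩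
  exact ⟨C, (norm_nonneg _).trans (hC' 0), hC'⟩

/-- Jacobi triple product. -/
lemma jtp {q z : ℂ} (hq : ‖q‖ < 1) (hq0 : q ≠ 0) (hz : z ≠ 0) (t : ℤ → ℂ)
    (t0 : t 0 = 1) (ht : ∀ j, t (j + 1) = t j * q ^ j * z) (hs : Summable fun j => ‖t j‖) :
    ∑' j, t j = EP q (-q) * EP q z * EP q (q / z) := by
  obtain ⟨C, hC0, hC⟩ := rq_bdd hq
  obtain ⟨B, hB0, hB⟩ := qfac_bdd hq
  have h2 : Tendsto (fun m : ℕ => 2 * m) atTop atTop :=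
    tendsto_id.const_mul_atTop' (by norm_num)
  have h := tendsto_tsum_of_dominated_convergence (𝓕 := atTop)
    (f := fun (m : ℕ) (j : ℤ) => qfac q (2 * m) * rq q (m + j) * rq q (m - j) * t j)
    (g := fun j => EP q (-q) * (EP q (-q))⁻¹ * (EP q (-q))⁻¹ * t j)
    (bound := fun j => B * C * C * ‖t j‖) (hs.mul_left _) (fun j => by
      refine Tendsto.mul (Tendsto.mul (Tendsto.mul ?_ ?_) ?_) tendsto_const_nhds
      · exact (qfac_tendsto hq).comp h2
      · exact (rq_tendsto hq).comp (tendsto_atTop_add_const_right _ j tendsto_natCast_atTop_atTop)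
      · exact (rq_tendsto hq).comp
          (tendsto_atTop_add_const_right _ (-j) tendsto_natCast_atTop_atTop)) (by
      refine Eventually.of_forall fun m j => ?_
      rw [norm_mul, norm_mul, norm_mul]
      gcongr
      · exact hB _
      · exact hC _
      · exact hC _)
  have h' := ((EP_tendsto hq z).mul (EP_tendsto hq (q / z)))
  have hu := tendsto_nhds_unique h (h'.congr fun m => by
    rw [(finite_jtp hq hq0 hz t t0 ht m).tsum_eq, Finset.prod_mul_distrib])
  rw [tsum_mul_left] at hu
  have hne := qinf_ne hq
  rw [mul_assoc, ← hu]
  field_simp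

lemma euler_aux (q : ℂ) (m : ℕ) : qfac q (2 * m) =
    qfac q m * ∏ k ∈ Finset.range m, ((1 - q ^ (2 * k + 1)) * (1 + q ^ k * q)) := by
  induction m with
  | zero => simp [qfac]
  | succ m ih =>
    rw [show 2 * (m + 1) = 2 * m + 1 + 1 by ring, qfac_succ, qfac_succ, ih, qfac_succ,
      Finset.prod_range_succ]
    ring

/-- Euler: `∏ (1 - s^(2k+1)) (1 + s^(2k+1)) (1 + q^(k+1)) = 1` with `q = s^2`. -/
lemma euler_id {s : ℂ} (hs : ‖s‖ < 1) :
    EP (s ^ 2) (-s) * EP (s ^ 2) s * EP (s ^ 2) (s ^ 2) = 1 := by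
  have hq : ‖s ^ 2‖ < 1 := by rw [norm_pow]; exact pow_lt_one₀ (norm_nonneg _) hs two_ne_zero
  have h2 : Tendsto (fun m : ℕ => 2 * m) atTop atTop :=
    tendsto_id.const_mul_atTop' (by norm_num)
  have h := ((EP_tendsto hq (-s)).mul (EP_tendsto hq s)).mul (EP_tendsto hq (s ^ 2))
  have h' := ((qfac_tendsto hq).comp h2).div (qfac_tendsto hq) (qinf_ne hq)
  rw [div_self (qinf_ne hq)] at h'
  refine tendsto_nhds_unique h (h'.congr fun m => ?_)
  simp only [Pi.div_apply, Function.comp]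
  rw [euler_aux, mul_div_cancel_left₀ _ (qfac_ne hq m), ← Finset.prod_mul_distrib,
    ← Finset.prod_mul_distrib]
  exact Finset.prod_congr rfl fun k _ => by ring

lemma nome_norm {τ : ℂ} (hτ : 0 < τ.im) : ‖cexp (Real.pi * I * τ)‖ < 1 := by
  rw [Complex.norm_exp, Real.exp_lt_one_iff]
  have := mul_pos Real.pi_pos hτ
  simp
  linarith

lemma q_norm {τ : ℂ} (hτ : 0 < τ.im) : ‖cexp (Real.pi * I * τ) ^ 2‖ < 1 := by
  rw [norm_pow]; exact pow_lt_one₀ (norm_nonneg _) (nome_norm hτ) two_ne_zero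

lemma theta_prod {τ : ℂ} (hτ : 0 < τ.im) (v : ℂ) :
    jacobiTheta₂ v τ = EP (cexp (Real.pi * I * τ) ^ 2) (-cexp (Real.pi * I * τ) ^ 2) *
      EP (cexp (Real.pi * I * τ) ^ 2) (cexp (Real.pi * I * τ) * cexp (2 * Real.pi * I * v)) *
      EP (cexp (Real.pi * I * τ) ^ 2) (cexp (Real.pi * I * τ) * cexp (-(2 * Real.pi * I * v))) := by
  rw [jacobiTheta₂, jtp (q_norm hτ) (pow_ne_zero _ (exp_ne_zero _))
    (z := cexp (Real.pi * I * τ) * cexp (2 * Real.pi * I * v))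
    (mul_ne_zero (exp_ne_zero _) (exp_ne_zero _))]
  · congr 2
    rw [exp_neg]
    have := exp_ne_zero (Real.pi * I * τ)
    field_simp
  · simp [jacobiTheta₂_term]
  · intro j
    rw [jacobiTheta₂_term, jacobiTheta₂_term, ← Complex.exp_nat_mul, ← Complex.exp_int_mul,
      ← Complex.exp_add, ← Complex.exp_add, ← Complex.exp_add]
    congr 1
    push_cast
    ring
  · exact ((summable_jacobiTheta₂_term_iff v τ).mpr hτ).norm

lemma theta_const_prod {τ : ℂ} (hτ : 0 < τ.im) :
    jacobiTheta₂ 0 τ * jacobiTheta₂ (1 / 2) τ * jacobiTheta₂ (τ / 2) τ =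
      2 * EP (cexp (Real.pi * I * τ) ^ 2) (-cexp (Real.pi * I * τ) ^ 2) ^ 3 := by
  have hE := euler_id (nome_norm hτ)
  have h1 : cexp (2 * Real.pi * I * (1 / 2)) = -1 := by
    rw [← exp_pi_mul_I]; congr 1; ring
  have h2 : cexp (-(2 * Real.pi * I * (1 / 2))) = -1 := by
    rw [exp_neg, h1]; norm_num
  have h3 : cexp (2 * Real.pi * I * (τ / 2)) = cexp (Real.pi * I * τ) := by congr 1; ring
  have h4 : cexp (-(2 * Real.pi * I * (τ / 2))) = (cexp (Real.pi * I * τ))⁻¹ := by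
    rw [exp_neg, h3]
  rw [theta_prod hτ, theta_prod hτ, theta_prod hτ, h1, h2, h3, h4]
  have hq := q_norm hτ
  have hs := exp_ne_zero (Real.pi * I * τ)
  generalize cexp (Real.pi * I * τ) = s at *
  rw [mul_inv_cancel₀ hs, EP_rec hq 1]
  simp only [mul_zero, neg_zero, exp_zero, mul_one, mul_neg, ← pow_two]
  generalize EP (s ^ 2) (-s ^ 2) = Q
  calc _ = 2 * Q ^ 3 * (EP (s ^ 2) (-s) * EP (s ^ 2) s * EP (s ^ 2) (s ^ 2)) ^ 2 := by ring
    _ = _ := by rw [hE]; ring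

lemma theta_const_ne {τ : ℂ} (hτ : 0 < τ.im) :
    jacobiTheta₂ 0 τ ≠ 0 ∧ jacobiTheta₂ (1 / 2) τ ≠ 0 ∧ jacobiTheta₂ (τ / 2) τ ≠ 0 := by
  have h := theta_const_prod hτ
  have hne : 2 * EP (cexp (Real.pi * I * τ) ^ 2) (-cexp (Real.pi * I * τ) ^ 2) ^ 3 ≠ 0 :=
    mul_ne_zero two_ne_zero (pow_ne_zero _ (qinf_ne (q_norm hτ)))
  rw [← h] at hne
  rw [mul_ne_zero_iff, mul_ne_zero_iff] at hne
  exact ⟨hne.1.1, hne.1.2, hne.2⟩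

lemma theta_zero_iff {τ : ℂ} (hτ : 0 < τ.im) (a : ℂ) :
    jacobiTheta₂ (a + 1 / 2 + τ / 2) τ = 0 ↔ ∃ n : ℤ, 1 - cexp (2 * Real.pi * I * (a + n * τ)) = 0 := by
  have e1 : ∀ k : ℕ, 1 + (cexp (Real.pi * I * τ) ^ 2) ^ k *
      (cexp (Real.pi * I * τ) * cexp (2 * Real.pi * I * (a + 1 / 2 + τ / 2))) =
      1 - cexp (2 * Real.pi * I * (a + (k + 1 : ℕ) * τ)) := by
    intro k
    rw [← pow_mul, ← exp_nat_mul, ← exp_add, ← exp_add, sub_eq_add_neg, ← neg_one_mul,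
      ← exp_pi_mul_I, ← exp_add]
    congr 2
    push_cast; ring
  have e2 : ∀ k : ℕ, 1 + (cexp (Real.pi * I * τ) ^ 2) ^ k *
      (cexp (Real.pi * I * τ) * cexp (-(2 * Real.pi * I * (a + 1 / 2 + τ / 2)))) =
      1 - (cexp (2 * Real.pi * I * (a + (-k : ℤ) * τ)))⁻¹ := by
    intro k
    have : (-1 : ℂ) = cexp (-(Real.pi * I)) := by rw [exp_neg, exp_pi_mul_I]; norm_num
    rw [← pow_mul, ← exp_nat_mul, ← exp_add, ← exp_add, sub_eq_add_neg,
      neg_eq_neg_one_mul (cexp _)⁻¹, this, ← exp_neg, ← exp_add]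
    congr 2
    push_cast; ring
  rw [theta_prod hτ]
  constructor
  · intro h
    by_contra! hn
    refine absurd h (mul_ne_zero (mul_ne_zero (qinf_ne (q_norm hτ)) ?_) ?_)
    · refine EP_ne_zero (q_norm hτ) _ fun k => ?_
      rw [e1]; exact_mod_cast hn (k + 1 : ℕ)
    · refine EP_ne_zero (q_norm hτ) _ fun k => ?_
      rw [e2, sub_ne_zero]
      intro h'
      have h'' : cexp (2 * Real.pi * I * (a + (-k : ℤ) * τ)) = 1 := by
        rw [← inv_inj, ← h', inv_one]
      exact hn (-k) (by rw [h'', sub_self])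
  · rintro ⟨n, hn⟩
    rcases le_or_gt n 0 with h | h
    · obtain ⟨k, rfl⟩ : ∃ k : ℕ, n = -k := ⟨n.natAbs, by omega⟩
      rw [EP_eq_zero (q := cexp (Real.pi * I * τ) ^ 2) (cexp (Real.pi * I * τ) *
        cexp (-(2 * Real.pi * I * (a + 1 / 2 + τ / 2)))) k, mul_zero]
      rw [e2, ← sub_eq_zero.mp hn]; simp
    · obtain ⟨k, rfl⟩ : ∃ k : ℕ, n = (k + 1 : ℕ) := ⟨n.natAbs - 1, by omega⟩
      rw [EP_eq_zero (q := cexp (Real.pi * I * τ) ^ 2) (cexp (Real.pi * I * τ) *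
        cexp (2 * Real.pi * I * (a + 1 / 2 + τ / 2))) k, mul_zero, zero_mul]
      rw [e1]; exact_mod_cast hn

lemma theta_deriv {τ : ℂ} (hτ : 0 < τ.im) :
    HasDerivAt (fun v => jacobiTheta₂ v τ)
      (Real.pi * I * (jacobiTheta₂ 0 τ * jacobiTheta₂ (1 / 2) τ * jacobiTheta₂ (τ / 2) τ))
      (1 / 2 + τ / 2) := by
  rw [theta_const_prod hτ]
  have hq := q_norm hτ
  set s := cexp (Real.pi * I * τ) with hs
  set K : ℂ → ℂ := fun v => EP (s ^ 2) (-s ^ 2) * EP (s ^ 2) (s * cexp (2 * Real.pi * I * v)) *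
    EP (s ^ 2) (s ^ 2 * (s * cexp (-(2 * Real.pi * I * v)))) with hK
  have hprod : (fun v => jacobiTheta₂ v τ) =
      fun v => (1 + s * cexp (-(2 * Real.pi * I * v))) * K v := by
    funext v
    rw [theta_prod hτ, EP_rec hq (s * cexp (-(2 * Real.pi * I * v)))]
    simp only [hK]; ring
  have hKc : Continuous K := by
    have := EP_continuous hq
    simp only [hK]
    fun_prop
  have z1 : s * cexp (2 * Real.pi * I * (1 / 2 + τ / 2)) = -s ^ 2 := by
    rw [hs, ← exp_nat_mul, ← exp_add, ← neg_one_mul, ← exp_pi_mul_I, ← exp_add]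
    congr 1; push_cast; ring
  have z2 : s * cexp (-(2 * Real.pi * I * (1 / 2 + τ / 2))) = -1 := by
    rw [hs, ← exp_add, ← inv_neg_one, ← exp_pi_mul_I, ← exp_neg]
    congr 1; ring
  have hK0 : K (1 / 2 + τ / 2) = EP (s ^ 2) (-s ^ 2) ^ 3 := by
    simp only [hK]
    rw [z1, z2, mul_neg_one]; ring
  have hd : HasDerivAt (fun v => 1 + s * cexp (-(2 * Real.pi * I * v))) (2 * Real.pi * I)
      (1 / 2 + τ / 2) := by
    have h := ((((hasDerivAt_id (1 / 2 + τ / 2)).const_mul (2 * Real.pi * I)).neg.cexp).const_mul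
      s).const_add 1
    refine h.congr_deriv ?_
    have z2' := z2
    simp only [id, Pi.neg_apply] at *
    rw [← mul_assoc, z2']; ring
  rw [hprod]
  rw [hasDerivAt_iff_tendsto_slope] at hd ⊢
  have h2 := hd.mul (hKc.tendsto (1 / 2 + τ / 2) |>.mono_left nhdsWithin_le_nhds)
  rw [hK0] at h2
  refine (h2.congr fun v => ?_).trans (le_of_eq ?_)
  · rw [slope_def_field, slope_def_field, z2]; ring
  · congr 1; ring

/-- Denominators of the Appell–Lerch sums. -/
def den (τ a : ℂ) (n : ℤ) : ℂ := 1 - cexp (2 * Real.pi * I * (a + n * τ))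

lemma den_differentiable (τ : ℂ) (n : ℤ) : Differentiable ℂ (fun a => den τ a n) := by
  unfold den; fun_prop

lemma den_lower (τ a : ℂ) (n : ℤ) (h : 1 ≤ |a.im + n * τ.im|) : 1 / 2 ≤ ‖den τ a n‖ := by
  have hn : ‖cexp (2 * Real.pi * I * (a + n * τ))‖ = Real.exp (-(2 * Real.pi * (a.im + n * τ.im))) := by
    rw [Complex.norm_exp]; congr 1; simp
  have hpi := Real.pi_gt_three
  have h2 : 2 ≤ Real.exp (2 * Real.pi) := by
    have := Real.add_one_le_exp (2 * Real.pi); linarith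
  rcases le_abs.mp h with h | h
  · have : ‖cexp (2 * Real.pi * I * (a + n * τ))‖ ≤ 1 / 2 := by
      rw [hn, Real.exp_neg, one_div]
      gcongr
      refine h2.trans (Real.exp_le_exp.mpr ?_)
      nlinarith
    have h3 := norm_sub_norm_le (1 : ℂ) (cexp (2 * Real.pi * I * (a + n * τ)))
    rw [norm_one] at h3
    rw [den]; linarith
  · have : 2 ≤ ‖cexp (2 * Real.pi * I * (a + n * τ))‖ := by
      rw [hn]
      refine h2.trans (Real.exp_le_exp.mpr ?_)
      nlinarith
    have h3 := norm_sub_norm_le (cexp (2 * Real.pi * I * (a + n * τ))) (1 : ℂ)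
    rw [norm_one, norm_sub_rev] at h3
    rw [den]; linarith

lemma AL_analytic {τ : ℂ} (hτ : 0 < τ.im) (c : ℤ → ℂ) (hc : Summable fun n => ‖c n‖) (a₀ : ℂ)
    (h : ∀ n, c n = 0 ∨ den τ a₀ n ≠ 0) :
    AnalyticAt ℂ (fun a => ∑' n, c n / den τ a n) a₀ ∧ Summable fun n => c n / den τ a₀ n := by
  obtain ⟨N, hN⟩ := exists_nat_ge ((|a₀.im| + 2) / τ.im)
  rw [div_le_iff₀ hτ] at hN
  set T : Finset ℤ := Finset.Icc (-(N : ℤ)) N with hT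
  have hout : ∀ n, n ∉ T → ∀ a ∈ Metric.ball a₀ 1, 1 / 2 ≤ ‖den τ a n‖ := by
    intro n hn a ha
    apply den_lower
    rw [mem_ball_iff_norm] at ha
    have h1 : |a.im - a₀.im| ≤ 1 := by
      have := abs_im_le_norm (a - a₀); rw [sub_im] at this; linarith
    have h2 : (N : ℝ) ≤ |(n : ℝ)| := by
      rw [hT, Finset.mem_Icc] at hn
      have : (N : ℤ) ≤ |n| := by
        by_contra! hlt
        rw [abs_lt] at hlt
        exact hn ⟨hlt.1.le, hlt.2.le⟩
      exact_mod_cast this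
    have h3 : |a₀.im| + 2 ≤ |(n : ℝ) * τ.im| := by
      rw [abs_mul, abs_of_pos hτ]; nlinarith
    have h4 : |(n : ℝ) * τ.im| ≤ |a.im + n * τ.im| + |a.im - a₀.im| + |a₀.im| := by
      have e : (n : ℝ) * τ.im = (a.im + n * τ.im) - (a.im - a₀.im) - a₀.im := by ring
      calc _ = |(a.im + n * τ.im) - (a.im - a₀.im) - a₀.im| := by rw [← e]
        _ ≤ _ := (abs_sub _ _).trans (by gcongr; exact abs_sub _ _)
    linarith
  set U : Set ℂ := Metric.ball a₀ 1 ∩ ⋂ n ∈ T, {a | c n = 0 ∨ ‖den τ a₀ n‖ / 2 < ‖den τ a n‖} with hU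
  have hUo : IsOpen U := by
    refine Metric.isOpen_ball.inter (isOpen_biInter_finset fun n _ => ?_)
    by_cases hcn : c n = 0
    · simp [hcn]
    · simp only [hcn, false_or]
      exact isOpen_lt continuous_const (den_differentiable τ n).continuous.norm
  have ha₀ : a₀ ∈ U := by
    refine ⟨Metric.mem_ball_self one_pos, Set.mem_iInter₂.mpr fun n _ => ?_⟩
    rcases h n with h | h
    · exact Or.inl h
    · right
      have := norm_pos_iff.mpr h
      linarith
  set u : ℤ → ℝ := fun n => if n ∈ T then ‖c n‖ / (‖den τ a₀ n‖ / 2) else ‖c n‖ / (1 / 2) with hu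
  have hus : Summable u := by
    refine (hc.div_const (1 / 2)).congr_cofinite ?_
    refine Filter.eventually_cofinite.mpr (T.finite_toSet.subset fun n hn => ?_)
    by_contra hnT
    rw [Finset.mem_coe] at hnT
    exact hn (by simp only [hu]; rw [if_neg hnT])
  have hpos : ∀ n, ∀ a ∈ U, c n = 0 ∨ den τ a n ≠ 0 := by
    intro n a ha
    by_cases hnT : n ∈ T
    · rcases Set.mem_iInter₂.mp ha.2 n hnT with h1 | h1
      · exact Or.inl h1
      · right
        rw [← norm_pos_iff]
        exact lt_of_le_of_lt (by positivity) h1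
    · right
      rw [← norm_pos_iff]
      linarith [hout n hnT a ha.1]
  have hb : ∀ n, ∀ a ∈ U, ‖c n / den τ a n‖ ≤ u n := by
    intro n a ha
    rw [norm_div]
    simp only [hu]
    split_ifs with hnT
    · rcases Set.mem_iInter₂.mp ha.2 n hnT with h1 | h1
      · simp [h1]
      · rcases h n with h2 | h2
        · simp [h2]
        · have := norm_pos_iff.mpr h2
          gcongr
    · have := hout n hnT a ha.1
      gcongr
  constructor
  · have := differentiableOn_tsum_of_summable_norm (F := fun n a => c n / den τ a n) hus
      (fun n a ha => by
        rcases hpos n a ha with h1 | h1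
        · simp only [h1, zero_div]; exact differentiableWithinAt_const _
        · exact ((differentiableAt_const _).div (den_differentiable τ n a) h1).differentiableWithinAt)
      hUo hb
    exact this.analyticAt (hUo.mem_nhds ha₀)
  · exact Summable.of_norm_bounded hus fun n => hb n a₀ ha₀

/-- Appell–Lerch sum. -/
def AL (τ a b : ℂ) : ℂ := ∑' n : ℤ, jacobiTheta₂_term n b τ / den τ a n

lemma den_add_one (τ a : ℂ) (n : ℤ) : den τ (a + 1) n = den τ a n := by
  rw [den, den, show 2 * (Real.pi : ℂ) * I * (a + 1 + n * τ) =
    2 * Real.pi * I * (a + n * τ) + 2 * Real.pi * I by ring, exp_periodic]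

lemma AL_add_one (τ a b : ℂ) : AL τ (a + 1) b = AL τ a b := by
  simp only [AL, den_add_one]

lemma den_add_tau (τ a : ℂ) (n : ℤ) : den τ (a + τ) n = den τ a (n + 1) := by
  rw [den, den]; congr 3; push_cast; ring

lemma term_norm_summable {τ : ℂ} (hτ : 0 < τ.im) (b : ℂ) :
    Summable fun n => ‖jacobiTheta₂_term n b τ‖ :=
  ((summable_jacobiTheta₂_term_iff b τ).mpr hτ).norm

lemma AL_add_tau {τ : ℂ} (hτ : 0 < τ.im) (a b : ℂ) (h : ∀ n, den τ a n ≠ 0) :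
    AL τ (a + τ) b = jacobiTheta₂ b τ +
      cexp (2 * Real.pi * I * (a - b)) * cexp (Real.pi * I * τ) * AL τ a b := by
  have hs := (AL_analytic hτ _ (term_norm_summable hτ b) a fun n => Or.inr (h n)).2
  rw [AL, ← (Equiv.subRight (1 : ℤ)).tsum_eq]
  have hterm : ∀ n : ℤ, jacobiTheta₂_term (n - 1) b τ / den τ (a + τ) (n - 1) =
      cexp (Real.pi * I * (τ - 2 * b)) * jacobiTheta₂_term n (b - τ) τ +
      cexp (2 * Real.pi * I * (a - b)) * cexp (Real.pi * I * τ) *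
        (jacobiTheta₂_term n b τ / den τ a n) := by
    intro n
    rw [den_add_tau, sub_add_cancel, ← mul_div_assoc, div_eq_iff (h n), add_mul,
      div_mul_cancel₀ _ (h n), den]
    simp only [jacobiTheta₂_term, mul_sub, mul_one, ← exp_add, mul_assoc, ← exp_add]
    have e1 : ∀ A B C D : ℂ, C = D → A = B → A = B - C + D := by
      intro A B C D h1 h2; rw [h1, h2]; ring
    apply e1
    · congr 1; ring
    · congr 1; push_cast; ring
  simp only [Equiv.subRight_apply, hterm]
  rw [Summable.tsum_add (((summable_jacobiTheta₂_term_iff _ τ).mpr hτ).mul_left _)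
    (hs.mul_left _), tsum_mul_left, tsum_mul_left]
  have hth := jacobiTheta₂_add_left' (b - τ) τ
  rw [sub_add_cancel] at hth
  rw [hth, AL, jacobiTheta₂]
  congr 3
  ring

/-- `P` agrees with an analytic function near `x` (punctured). -/
def PExt (P : ℂ → ℂ) (x : ℂ) : Prop := ∃ g : ℂ → ℂ, AnalyticAt ℂ g x ∧ P =ᶠ[𝓝[≠] x] g

lemma tendsto_add_punct (x p : ℂ) : Tendsto (fun y => y + p) (𝓝[≠] x) (𝓝[≠] (x + p)) := by
  refine tendsto_nhdsWithin_of_tendsto_nhds_of_eventually_within _ ?_ ?_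
  · exact (Continuous.tendsto (by fun_prop) x).mono_left nhdsWithin_le_nhds
  · filter_upwards [self_mem_nhdsWithin] with y hy
    intro h
    exact hy (add_right_cancel h)

lemma PExt.add {P : ℂ → ℂ} {p : ℂ} (hP : ∀ x, ∀ᶠ y in 𝓝[≠] x, P (y + p) = -P y) {x : ℂ}
    (h : PExt P x) : PExt P (x + p) := by
  obtain ⟨g, hg, hPg⟩ := h
  refine ⟨fun y => -g (y - p), ?_, ?_⟩
  · have : AnalyticAt ℂ g ((x + p) - p) := by rwa [add_sub_cancel_right]
    exact (AnalyticAt.fun_comp (f := fun y : ℂ => y - p) this (by fun_prop)).neg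
  · have ht := tendsto_add_punct (x + p) (-p)
    rw [add_neg_cancel_right] at ht
    filter_upwards [ht.eventually hPg, ht.eventually (hP x)] with y h1 h2
    rw [neg_add_cancel_right] at h2
    rw [h2, h1, sub_eq_add_neg]

lemma PExt.sub {P : ℂ → ℂ} {p : ℂ} (hP : ∀ x, ∀ᶠ y in 𝓝[≠] x, P (y + p) = -P y) {x : ℂ}
    (h : PExt P x) : PExt P (x - p) := by
  obtain ⟨g, hg, hPg⟩ := h
  refine ⟨fun y => -g (y + p), ?_, ?_⟩
  · have : AnalyticAt ℂ g ((x - p) + p) := by rwa [sub_add_cancel]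
    exact (AnalyticAt.fun_comp (f := fun y : ℂ => y + p) this (by fun_prop)).neg
  · have ht := tendsto_add_punct (x - p) p
    rw [sub_add_cancel] at ht
    filter_upwards [ht.eventually hPg, hP (x - p)] with y h1 h2
    rw [← h1, h2, neg_neg]

lemma PExt.add_int {P : ℂ → ℂ} {p : ℂ} (hP : ∀ x, ∀ᶠ y in 𝓝[≠] x, P (y + p) = -P y) {x : ℂ}
    (h : PExt P x) (n : ℤ) : PExt P (x + n * p) := by
  induction n using Int.induction_on with
  | zero => simpa using h
  | succ n ih =>
    have := ih.add hP
    convert this using 1; push_cast; ring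
  | pred n ih =>
    have := ih.sub hP
    convert this using 1; push_cast; ring

lemma norm_add_int {f : ℂ → ℂ} {p : ℂ} (hf : ∀ x, f (x + p) = -f x) (x : ℂ) (n : ℤ) :
    ‖f (x + n * p)‖ = ‖f x‖ := by
  induction n using Int.induction_on with
  | zero => simp
  | succ n ih =>
    rw [← ih, ← norm_neg (f (x + ((n : ℤ) : ℂ) * p)), ← hf]
    congr 2; push_cast; ring
  | pred n ih =>
    rw [← ih, ← norm_neg, ← hf]
    congr 2; push_cast; ring

lemma entire_antiperiodic_zero {f : ℂ → ℂ} {τ : ℂ} (hτ : 0 < τ.im) (hf : Differentiable ℂ f)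
    (h1 : ∀ x, f (x + 1) = -f x) (h2 : ∀ x, f (x + τ) = -f x) (x : ℂ) : f x = 0 := by
  set K : Set ℂ := (fun p : ℝ × ℝ => (p.1 : ℂ) + p.2 * τ) '' (Set.Icc 0 1 ×ˢ Set.Icc 0 1) with hK
  have hKc : IsCompact K := (isCompact_Icc.prod isCompact_Icc).image (by fun_prop)
  obtain ⟨C, hC⟩ := hKc.exists_bound_of_continuousOn hf.continuous.continuousOn
  have hb : ∀ z, ‖f z‖ ≤ C := by
    intro z
    set b := z.im / τ.im with hbdef
    set a := z.re - b * τ.re with hadef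
    have hz : z = a + b * τ := by
      apply Complex.ext
      · simp [hadef]
      · simp [hbdef]; field_simp
    have : f z = f (((Int.fract a : ℝ) + (Int.fract b : ℝ) * τ + (⌊a⌋ : ℤ) * 1) + (⌊b⌋ : ℤ) * τ) := by
      congr 1
      rw [hz]
      have ea : ((Int.fract a : ℝ) : ℂ) = a - (⌊a⌋ : ℤ) := by
        rw [← Int.self_sub_floor]; push_cast; ring
      have eb : ((Int.fract b : ℝ) : ℂ) = b - (⌊b⌋ : ℤ) := by
        rw [← Int.self_sub_floor]; push_cast; ring
      rw [ea, eb]; ring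
    rw [this, norm_add_int h2, norm_add_int h1]
    apply hC
    exact ⟨(Int.fract a, Int.fract b), ⟨⟨Int.fract_nonneg _, (Int.fract_lt_one _).le⟩,
      ⟨Int.fract_nonneg _, (Int.fract_lt_one _).le⟩⟩, rfl⟩
  have hbd : Bornology.IsBounded (Set.range f) := by
    rw [isBounded_iff_forall_norm_le]
    exact ⟨C, by rintro _ ⟨z, rfl⟩; exact hb z⟩
  have hc := hf.apply_eq_apply_of_bounded hbd (x + 1) x
  rw [h1] at hc
  linear_combination (-1 / 2 : ℂ) * hc

lemma ext_zero {P : ℂ → ℂ} {τ : ℂ} (hτ : 0 < τ.im) (hext : ∀ x, PExt P x)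
    (h1 : ∀ x, ∀ᶠ y in 𝓝[≠] x, P (y + 1) = -P y)
    (h2 : ∀ x, ∀ᶠ y in 𝓝[≠] x, P (y + τ) = -P y) (x : ℂ) : ∀ᶠ y in 𝓝[≠] x, P y = 0 := by
  choose g hg hPg using hext
  set Q : ℂ → ℂ := fun x => g x x with hQ
  have hQg : ∀ x, Q =ᶠ[𝓝 x] g x := by
    intro x
    rw [Filter.EventuallyEq, ← nhdsNE_sup_pure, eventually_sup]
    refine ⟨?_, eventually_pure.mpr rfl⟩
    have e1 : ∀ᶠ y in 𝓝[≠] x, AnalyticAt ℂ (g x) y :=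
      (hg x).eventually_analyticAt.filter_mono nhdsWithin_le_nhds
    have e2 := eventually_eventually_nhdsWithin.mpr (hPg x)
    have e2' : ∀ᶠ y in 𝓝[≠] x, ∀ᶠ z in 𝓝 y, z ≠ x → P z = g x z := by
      have := (eventually_nhdsWithin_iff.mp (hPg x)).eventually_nhds
      exact this.filter_mono nhdsWithin_le_nhds
    filter_upwards [e1, e2', self_mem_nhdsWithin] with y h1 h2 hy
    have h3 : ∀ᶠ z in 𝓝[≠] y, g y z = g x z := by
      filter_upwards [h2.filter_mono nhdsWithin_le_nhds, hPg y,
        (isOpen_ne.mem_nhds hy : {z | z ≠ x} ∈ 𝓝 y) |> fun h => nhdsWithin_le_nhds h] with z a b c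
      rw [← b, a c]
    have t1 : Tendsto (g y) (𝓝[≠] y) (𝓝 (g y y)) :=
      ((hg y).continuousAt.tendsto).mono_left nhdsWithin_le_nhds
    have t2 : Tendsto (g x) (𝓝[≠] y) (𝓝 (g x y)) :=
      (h1.continuousAt.tendsto).mono_left nhdsWithin_le_nhds
    exact tendsto_nhds_unique t1 (t2.congr' (h3.mono fun z hz => hz.symm))
  have hQd : Differentiable ℂ Q := fun x =>
    ((hg x).congr (hQg x).symm).differentiableAt
  have hQP : ∀ x, P =ᶠ[𝓝[≠] x] Q := fun x =>
    (hPg x).trans ((hQg x).symm.filter_mono nhdsWithin_le_nhds)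
  have anti : ∀ p, (∀ x, ∀ᶠ y in 𝓝[≠] x, P (y + p) = -P y) → ∀ x, Q (x + p) = -Q x := by
    intro p hp x
    have e : ∀ᶠ y in 𝓝[≠] x, Q (y + p) = -Q y := by
      filter_upwards [hp x, hQP x, (tendsto_add_punct x p).eventually (hQP (x + p))] with y a b c
      rw [← c, a, b]
    have hc := hQd.continuous
    have t1 : Tendsto (fun y => Q (y + p)) (𝓝[≠] x) (𝓝 (Q (x + p))) :=
      (Continuous.tendsto (f := fun y => Q (y + p)) (by fun_prop) x).mono_left nhdsWithin_le_nhds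
    have t2 : Tendsto (fun y => -Q y) (𝓝[≠] x) (𝓝 (-Q x)) :=
      (Continuous.tendsto (f := fun y => -Q y) (by fun_prop) x).mono_left nhdsWithin_le_nhds
    exact tendsto_nhds_unique t1 (t2.congr' (e.mono fun z hz => hz.symm))
  filter_upwards [hQP x] with y hy
  rw [hy, entire_antiperiodic_zero hτ hQd (anti 1 h1) (anti τ h2)]

/-- Cancellation of simple poles. -/
lemma simple_pole_cancel {f₁ f₂ h₁ h₂ : ℂ → ℂ} {a d₁ d₂ : ℂ} (hf₁ : AnalyticAt ℂ f₁ a)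
    (hf₂ : AnalyticAt ℂ f₂ a) (hh₁ : AnalyticAt ℂ h₁ a) (hh₂ : AnalyticAt ℂ h₂ a)
    (z₁ : f₁ a = 0) (z₂ : f₂ a = 0) (D₁ : HasDerivAt f₁ d₁ a) (D₂ : HasDerivAt f₂ d₂ a)
    (n₁ : d₁ ≠ 0) (n₂ : d₂ ≠ 0) (hr : h₁ a * d₂ + h₂ a * d₁ = 0) :
    PExt (fun x => h₁ x / f₁ x + h₂ x / f₂ x) a := by
  have key : ∀ f : ℂ → ℂ, AnalyticAt ℂ f a → AnalyticAt ℂ (dslope f a) a := by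
    intro f hf
    obtain ⟨p, hp⟩ := hf
    exact hp.has_fpower_series_dslope_fslope.analyticAt
  have s₁ : dslope f₁ a a = d₁ := by rw [dslope_same, D₁.deriv]
  have s₂ : dslope f₂ a a = d₂ := by rw [dslope_same, D₂.deriv]
  set N : ℂ → ℂ := fun x => h₁ x * dslope f₂ a x + h₂ x * dslope f₁ a x with hN
  have hNa : AnalyticAt ℂ N a := (hh₁.mul (key _ hf₂)).add (hh₂.mul (key _ hf₁))
  have hN0 : N a = 0 := by simp only [hN, s₁, s₂, hr]
  refine ⟨fun x => dslope N a x / (dslope f₁ a x * dslope f₂ a x), ?_, ?_⟩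
  · exact (key _ hNa).div ((key _ hf₁).mul (key _ hf₂)) (by rw [s₁, s₂]; exact mul_ne_zero n₁ n₂)
  · have c₁ : ∀ᶠ x in 𝓝[≠] a, dslope f₁ a x ≠ 0 :=
      ((key _ hf₁).continuousAt.eventually_ne (by rw [s₁]; exact n₁)).filter_mono nhdsWithin_le_nhds
    have c₂ : ∀ᶠ x in 𝓝[≠] a, dslope f₂ a x ≠ 0 :=
      ((key _ hf₂).continuousAt.eventually_ne (by rw [s₂]; exact n₂)).filter_mono nhdsWithin_le_nhds
    filter_upwards [c₁, c₂, self_mem_nhdsWithin] with x k₁ k₂ hx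
    have hxa : x - a ≠ 0 := sub_ne_zero.mpr hx
    have ds : ∀ f : ℂ → ℂ, f a = 0 → f x = (x - a) * dslope f a x := by
      intro f hf
      have := sub_smul_dslope f a x
      rw [hf, sub_zero, smul_eq_mul] at this
      exact this.symm
    have eN := ds N hN0
    rw [ds f₁ z₁, ds f₂ z₂]
    simp only [hN] at eN ⊢
    field_simp
    linear_combination eN

lemma J_diff {τ : ℂ} (hτ : 0 < τ.im) : Differentiable ℂ (fun v => jacobiTheta₂ v τ) :=
  fun v => differentiableAt_jacobiTheta₂_fst v hτ

lemma J_an {τ : ℂ} (hτ : 0 < τ.im) (s x : ℂ) : AnalyticAt ℂ (fun v => jacobiTheta₂ (v + s) τ) x := by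
  have h : Differentiable ℂ (fun v => jacobiTheta₂ (v + s) τ) :=
    (J_diff hτ).comp (differentiable_id.add_const s)
  exact h.analyticAt x

lemma J_an' {τ : ℂ} (hτ : 0 < τ.im) (x : ℂ) : AnalyticAt ℂ (fun v => jacobiTheta₂ v τ) x :=
  (J_diff hτ).analyticAt x

lemma J_ne {τ : ℂ} (hτ : 0 < τ.im) (s x : ℂ) : ∀ᶠ v in 𝓝[≠] x, jacobiTheta₂ (v + s) τ ≠ 0 := by
  rcases (J_an hτ s x).eventually_eq_zero_or_eventually_ne_zero with h | h
  · exfalso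
    have ha : AnalyticOnNhd ℂ (fun v => jacobiTheta₂ (v + s) τ) Set.univ := fun y _ => J_an hτ s y
    have := ha.eqOn_zero_of_preconnected_of_eventuallyEq_zero isPreconnected_univ
      (Set.mem_univ x) h (Set.mem_univ (-s))
    simp only [neg_add_cancel, Pi.zero_apply] at this
    exact (theta_const_ne hτ).1 this
  · exact h

lemma AL_an {τ : ℂ} (hτ : 0 < τ.im) (s x b : ℂ) (h : ∀ n, den τ (x + s) n ≠ 0) :
    AnalyticAt ℂ (fun v => AL τ (v + s) b) x := by
  have := (AL_analytic hτ _ (term_norm_summable hτ b) (x + s) fun n => Or.inr (h n)).1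
  exact AnalyticAt.fun_comp (f := fun v : ℂ => v + s) this (by fun_prop)

/-- Appell–Lerch sum without its central term. -/
def AL0 (τ a b : ℂ) : ℂ := ∑' n : ℤ, (if n = 0 then 0 else jacobiTheta₂_term n b τ) / den τ a n

lemma AL0_an {τ : ℂ} (hτ : 0 < τ.im) (s x b : ℂ) (h : ∀ n, n ≠ 0 → den τ (x + s) n ≠ 0) :
    AnalyticAt ℂ (fun v => AL0 τ (v + s) b) x := by
  have hs : Summable fun n : ℤ => ‖(if n = 0 then 0 else jacobiTheta₂_term n b τ)‖ := by
    refine Summable.of_nonneg_of_le (fun _ => norm_nonneg _) (fun n => ?_) (term_norm_summable hτ b)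
    split_ifs <;> simp
  have := (AL_analytic hτ _ hs (x + s) fun n => by
    by_cases hn : n = 0
    · left; simp [hn]
    · right; exact h n hn).1
  exact AnalyticAt.fun_comp (f := fun v : ℂ => v + s) this (by fun_prop)

lemma AL_split {τ : ℂ} (hτ : 0 < τ.im) (a b : ℂ) (h : ∀ n, den τ a n ≠ 0) :
    AL τ a b = 1 / den τ a 0 + AL0 τ a b := by
  have hs := (AL_analytic hτ _ (term_norm_summable hτ b) a fun n => Or.inr (h n)).2
  rw [AL, hs.tsum_eq_add_tsum_ite 0, AL0]
  congr 1
  · simp [jacobiTheta₂_term]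
  · congr 1; ext n; split_ifs <;> simp

lemma denA {τ : ℂ} (hτ : 0 < τ.im) {x : ℂ} (h : jacobiTheta₂ (x + τ / 2) τ ≠ 0) (n : ℤ) :
    den τ (x + 1 / 2) n ≠ 0 := by
  intro hn
  apply h
  have := (theta_zero_iff hτ (x - 1 / 2)).mpr ⟨n, by
    have h2 : den τ (x - 1 / 2 + 1) n = 0 := by rw [← hn]; congr 1; ring
    rwa [den_add_one] at h2⟩
  rwa [sub_add_cancel] at this

lemma denB {τ : ℂ} (hτ : 0 < τ.im) {x : ℂ} (h : jacobiTheta₂ (x + 1 / 2) τ ≠ 0) (n : ℤ) :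
    den τ (x + -(τ / 2)) n ≠ 0 := by
  intro hn
  apply h
  have := (theta_zero_iff hτ (x + -(τ / 2))).mpr ⟨n, hn⟩
  rwa [show x + -(τ / 2) + 1 / 2 + τ / 2 = x + 1 / 2 by ring] at this

lemma badA {τ : ℂ} (hτ : 0 < τ.im) {x : ℂ} (h : jacobiTheta₂ (x + τ / 2) τ = 0) :
    ∃ m n : ℤ, x = 1 / 2 + m * 1 + n * τ := by
  have h' : jacobiTheta₂ (x - 1 / 2 + 1 / 2 + τ / 2) τ = 0 := by rwa [sub_add_cancel]
  obtain ⟨n, hn⟩ := (theta_zero_iff hτ _).mp h'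
  obtain ⟨m, hm⟩ := exp_eq_one_iff.mp (sub_eq_zero.mp hn).symm
  have hpi := two_pi_I_ne_zero
  refine ⟨m, -n, ?_⟩
  have : x - 1 / 2 + n * τ = m := mul_left_cancel₀ hpi (by rw [hm]; ring)
  push_cast
  linear_combination this

lemma badB {τ : ℂ} (hτ : 0 < τ.im) {x : ℂ} (h : jacobiTheta₂ (x + 1 / 2) τ = 0) :
    ∃ m n : ℤ, x = τ / 2 + m * 1 + n * τ := by
  have h' : jacobiTheta₂ (x - τ / 2 + 1 / 2 + τ / 2) τ = 0 := by
    rwa [show x - τ / 2 + 1 / 2 + τ / 2 = x + 1 / 2 by ring]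
  obtain ⟨n, hn⟩ := (theta_zero_iff hτ _).mp h'
  obtain ⟨m, hm⟩ := exp_eq_one_iff.mp (sub_eq_zero.mp hn).symm
  have hpi := two_pi_I_ne_zero
  refine ⟨m, -n, ?_⟩
  have : x - τ / 2 + n * τ = m := mul_left_cancel₀ hpi (by rw [hm]; ring)
  push_cast
  linear_combination this

lemma den_int_ne {τ : ℂ} (hτ : 0 < τ.im) (a : ℂ) (ha : a.im = 0) (n : ℤ) (hn : n ≠ 0) :
    den τ a n ≠ 0 := by
  intro h
  obtain ⟨m, hm⟩ := exp_eq_one_iff.mp (sub_eq_zero.mp h).symm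
  have : a + n * τ = m := mul_left_cancel₀ two_pi_I_ne_zero (by rw [hm]; ring)
  have := congrArg Complex.im this
  simp [ha, hτ.ne', hn] at this

lemma den_hasDeriv (τ s x : ℂ) (h : cexp (2 * Real.pi * I * (x + s)) = 1) :
    HasDerivAt (fun v => den τ (v + s) 0) (-(2 * Real.pi * I)) x := by
  have h1 : HasDerivAt (fun v : ℂ => 2 * Real.pi * I * (v + s)) (2 * Real.pi * I) x := by
    simpa using ((hasDerivAt_id x).add_const s).const_mul (2 * Real.pi * I)
  have h2 := (h1.cexp).const_sub 1
  rw [h, one_mul] at h2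
  simpa [den] using h2

/-- The difference of the two sides, suitably normalised. -/
def Del (τ ρ : ℂ) : ℂ :=
  AL τ (ρ + -(τ / 2)) (1 / 2) / jacobiTheta₂ (1 / 2) τ
    - AL τ (ρ + 1 / 2) (τ / 2) / jacobiTheta₂ (τ / 2) τ
    + cexp (-(2 * Real.pi * I * ρ)) * jacobiTheta₂ 0 τ ^ 2 * jacobiTheta₂ ρ τ /
      (2 * jacobiTheta₂ (ρ + τ / 2) τ * jacobiTheta₂ (ρ + 1 / 2) τ)

lemma Del_an {τ : ℂ} (hτ : 0 < τ.im) {x : ℂ} (hA : jacobiTheta₂ (x + τ / 2) τ ≠ 0)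
    (hB : jacobiTheta₂ (x + 1 / 2) τ ≠ 0) : AnalyticAt ℂ (Del τ) x := by
  have a1 := AL_an hτ _ x (1 / 2) (denB hτ hB)
  have a2 := AL_an hτ _ x (τ / 2) (denA hτ hA)
  have a3 := J_an' hτ x
  have a4 := J_an hτ (τ / 2) x
  have a5 := J_an hτ (1 / 2) x
  have a6 : AnalyticAt ℂ (fun v => cexp (-(2 * Real.pi * I * v))) x := by fun_prop
  exact ((a1.div analyticAt_const (theta_const_ne hτ).2.1).sub
    (a2.div analyticAt_const (theta_const_ne hτ).2.2)).add
    (((a6.mul analyticAt_const).mul a3).div ((analyticAt_const.mul a4).mul a5)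
      (mul_ne_zero (mul_ne_zero two_ne_zero hA) hB))

lemma Del_add_one (τ ρ : ℂ) : Del τ (ρ + 1) = Del τ ρ := by
  have e1 : cexp (-(2 * Real.pi * I * (ρ + 1))) = cexp (-(2 * Real.pi * I * ρ)) := by
    rw [show -(2 * Real.pi * I * (ρ + 1)) = -(2 * Real.pi * I * ρ) - 2 * Real.pi * I by ring,
      exp_periodic.sub_eq]
  simp only [Del, add_right_comm ρ 1, AL_add_one, jacobiTheta₂_add_left, e1]

lemma exp_pi_add (z : ℂ) : cexp (z + Real.pi * I) = -cexp z := by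
  rw [exp_add, exp_pi_mul_I]; ring

lemma Del_add_tau {τ : ℂ} (hτ : 0 < τ.im) {ρ : ℂ} (hA : jacobiTheta₂ (ρ + τ / 2) τ ≠ 0)
    (hB : jacobiTheta₂ (ρ + 1 / 2) τ ≠ 0) :
    Del τ (ρ + τ) = -cexp (2 * Real.pi * I * ρ) * Del τ ρ := by
  obtain ⟨t0, t1, t2⟩ := theta_const_ne hτ
  have b1 : AL τ (ρ + τ + -(τ / 2)) (1 / 2) = jacobiTheta₂ (1 / 2) τ -
      cexp (2 * Real.pi * I * ρ) * AL τ (ρ + -(τ / 2)) (1 / 2) := by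
    rw [add_right_comm, AL_add_tau hτ _ _ (denB hτ hB), ← exp_add,
      show 2 * Real.pi * I * (ρ + -(τ / 2) - 1 / 2) + Real.pi * I * τ =
        2 * Real.pi * I * ρ - 2 * Real.pi * I + Real.pi * I by ring, exp_pi_add,
      exp_periodic.sub_eq]
    ring
  have b2 : AL τ (ρ + τ + 1 / 2) (τ / 2) = jacobiTheta₂ (τ / 2) τ -
      cexp (2 * Real.pi * I * ρ) * AL τ (ρ + 1 / 2) (τ / 2) := by
    rw [add_right_comm, AL_add_tau hτ _ _ (denA hτ hA), ← exp_add,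
      show 2 * Real.pi * I * (ρ + 1 / 2 - τ / 2) + Real.pi * I * τ =
        2 * Real.pi * I * ρ + Real.pi * I by ring, exp_pi_add]
    ring
  have c1 := jacobiTheta₂_add_left' ρ τ
  have c2 := jacobiTheta₂_add_left' (ρ + τ / 2) τ
  have c3 := jacobiTheta₂_add_left' (ρ + 1 / 2) τ
  have hE : cexp (-(2 * Real.pi * I * (ρ + τ))) * cexp (-Real.pi * I * (τ + 2 * ρ)) =
      -cexp (2 * Real.pi * I * ρ) * cexp (-(2 * Real.pi * I * ρ)) *
      (cexp (-Real.pi * I * (τ + 2 * (ρ + τ / 2))) * cexp (-Real.pi * I * (τ + 2 * (ρ + 1 / 2)))) := by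
    rw [← exp_pi_add, ← exp_add, ← exp_add, ← exp_add, ← exp_add]
    congr 1; ring
  have n2 := exp_ne_zero (-Real.pi * I * (τ + 2 * (ρ + τ / 2)))
  have n3 := exp_ne_zero (-Real.pi * I * (τ + 2 * (ρ + 1 / 2)))
  simp only [Del]
  rw [b1, b2, c1, show ρ + τ + τ / 2 = ρ + τ / 2 + τ by ring, c2,
    show ρ + τ + 1 / 2 = ρ + 1 / 2 + τ by ring, c3]
  generalize cexp (-(2 * Real.pi * I * (ρ + τ))) = E0 at *
  generalize cexp (-Real.pi * I * (τ + 2 * ρ)) = E1 at *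
  generalize cexp (-Real.pi * I * (τ + 2 * (ρ + τ / 2))) = E2 at *
  generalize cexp (-Real.pi * I * (τ + 2 * (ρ + 1 / 2))) = E3 at *
  generalize cexp (2 * Real.pi * I * ρ) = w at *
  generalize cexp (-(2 * Real.pi * I * ρ)) = w' at *
  generalize jacobiTheta₂ (ρ + τ / 2) τ = A at *
  generalize jacobiTheta₂ (ρ + 1 / 2) τ = B at *
  generalize jacobiTheta₂ (1 / 2) τ = T1 at *
  generalize jacobiTheta₂ (τ / 2) τ = T2 at *
  have r : E0 * jacobiTheta₂ 0 τ ^ 2 * (E1 * jacobiTheta₂ ρ τ) / (2 * (E2 * A) * (E3 * B)) =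
      -w * (w' * jacobiTheta₂ 0 τ ^ 2 * jacobiTheta₂ ρ τ / (2 * A * B)) := by
    rw [← mul_div_assoc, div_eq_div_iff (by simp [*]) (by simp [*])]
    linear_combination jacobiTheta₂ 0 τ ^ 2 * jacobiTheta₂ ρ τ * 2 * A * B * hE
  rw [r, sub_div, sub_div, div_self t1, div_self t2]
  ring

/-- The doubly antiperiodic function. -/
def PP (τ ρ : ℂ) : ℂ := cexp (Real.pi * I * ρ) * jacobiTheta₂ ρ τ * Del τ ρ

lemma PP_add_one (τ ρ : ℂ) : PP τ (ρ + 1) = -PP τ ρ := by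
  rw [PP, Del_add_one, jacobiTheta₂_add_left, PP, mul_add, mul_one, exp_pi_add]; ring

lemma PP_add_tau {τ : ℂ} (hτ : 0 < τ.im) {ρ : ℂ} (hA : jacobiTheta₂ (ρ + τ / 2) τ ≠ 0)
    (hB : jacobiTheta₂ (ρ + 1 / 2) τ ≠ 0) : PP τ (ρ + τ) = -PP τ ρ := by
  rw [PP, Del_add_tau hτ hA hB, jacobiTheta₂_add_left', PP]
  have : cexp (Real.pi * I * (ρ + τ)) * cexp (-Real.pi * I * (τ + 2 * ρ)) *
      cexp (2 * Real.pi * I * ρ) = cexp (Real.pi * I * ρ) := by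
    rw [← exp_add, ← exp_add]; congr 1; ring
  linear_combination -jacobiTheta₂ ρ τ * Del τ ρ * this

lemma PExt.of_an {P : ℂ → ℂ} {x : ℂ} (h : AnalyticAt ℂ P x) : PExt P x := ⟨P, h, EventuallyEq.rfl⟩

lemma PExt.an_add {P g : ℂ → ℂ} {x : ℂ} (h : PExt P x) (hg : AnalyticAt ℂ g x) :
    PExt (fun v => g v + P v) x := by
  obtain ⟨f, hf, h⟩ := h
  refine ⟨fun v => g v + f v, hg.add hf, ?_⟩
  filter_upwards [h] with v hv
  rw [hv]

lemma PExt.an_mul {P g : ℂ → ℂ} {x : ℂ} (h : PExt P x) (hg : AnalyticAt ℂ g x) :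
    PExt (fun v => g v * P v) x := by
  obtain ⟨f, hf, h⟩ := h
  refine ⟨fun v => g v * f v, hg.mul hf, ?_⟩
  filter_upwards [h] with v hv
  rw [hv]

lemma PExt.congr {P Q : ℂ → ℂ} {x : ℂ} (h : PExt P x) (hg : Q =ᶠ[𝓝[≠] x] P) : PExt Q x := by
  obtain ⟨f, hf, h⟩ := h
  exact ⟨f, hf, hg.trans h⟩

lemma PP_ext_of_Del {τ : ℂ} (hτ : 0 < τ.im) {x : ℂ} (h : PExt (Del τ) x) : PExt (PP τ) x := by
  have a6 : AnalyticAt ℂ (fun v => cexp (Real.pi * I * v)) x := by fun_prop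
  exact h.an_mul (a6.mul (J_an' hτ x))

lemma Del_ext_half {τ : ℂ} (hτ : 0 < τ.im) : PExt (Del τ) (1 / 2) := by
  obtain ⟨t0, t1, t2⟩ := theta_const_ne hτ
  have hone : jacobiTheta₂ (1 / 2 + 1 / 2) τ = jacobiTheta₂ 0 τ := by
    rw [show (1 / 2 + 1 / 2 : ℂ) = 0 + 1 by norm_num, jacobiTheta₂_add_left]
  have hB : jacobiTheta₂ (1 / 2 + 1 / 2) τ ≠ 0 := by rwa [hone]
  have a1 := AL_an hτ _ (1 / 2) (1 / 2) (denB hτ hB)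
  have a2 := AL0_an hτ (1 / 2) (1 / 2) (τ / 2) (den_int_ne hτ _ (by norm_num))
  have he : cexp (2 * Real.pi * I * (1 / 2 + 1 / 2)) = 1 := by
    rw [show 2 * (Real.pi : ℂ) * I * (1 / 2 + 1 / 2) = 2 * Real.pi * I by ring, exp_two_pi_mul_I]
  have he' : cexp (-(2 * Real.pi * I * (1 / 2))) = -1 := by
    rw [show -(2 * (Real.pi : ℂ) * I * (1 / 2)) = -(Real.pi * I) by ring, exp_neg, exp_pi_mul_I]
    norm_num
  have a6 : AnalyticAt ℂ (fun v => cexp (-(2 * Real.pi * I * v))) (1 / 2) := by fun_prop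
  have hd := theta_deriv hτ
  have hd2 : HasDerivAt (fun v => jacobiTheta₂ (v + τ / 2) τ) _ (1 / 2) := hd.comp_add_const _ _
  have hpi : (Real.pi : ℂ) * I ≠ 0 := mul_ne_zero (by exact_mod_cast Real.pi_ne_zero) I_ne_zero
  have key := simple_pole_cancel (a := 1 / 2) (f₁ := fun v => den τ (v + 1 / 2) 0)
    (f₂ := fun v => jacobiTheta₂ (v + τ / 2) τ) (h₁ := fun _ => -1 / jacobiTheta₂ (τ / 2) τ)
    (h₂ := fun v => cexp (-(2 * Real.pi * I * v)) * jacobiTheta₂ 0 τ ^ 2 * jacobiTheta₂ v τ /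
      (2 * jacobiTheta₂ (v + 1 / 2) τ))
    (by
      have : Differentiable ℂ (fun v => den τ (v + 1 / 2) 0) :=
        (den_differentiable τ 0).comp (differentiable_id.add_const _)
      exact this.analyticAt _)
    (J_an hτ _ _) analyticAt_const
    (((a6.mul analyticAt_const).mul (J_an' hτ _)).div (analyticAt_const.mul (J_an hτ _ _))
      (mul_ne_zero two_ne_zero hB))
    (by simp only [den, Int.cast_zero, zero_mul, add_zero]; rw [he, sub_self])
    (by
      have := (theta_zero_iff hτ 0).mpr ⟨0, by simp⟩
      simpa using this)
    (den_hasDeriv τ _ _ he) hd2 (by rw [neg_ne_zero, mul_assoc]; exact mul_ne_zero two_ne_zero hpi)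
    (mul_ne_zero hpi (mul_ne_zero (mul_ne_zero t0 t1) t2))
    (by
      simp only [he', hone]
      field_simp
      ring)
  refine (key.an_add ((a1.div analyticAt_const t1).sub (a2.div analyticAt_const t2))).congr ?_
  filter_upwards [J_ne hτ (τ / 2) (1 / 2)] with v hv
  simp only [Del, Pi.sub_apply, Pi.div_apply]
  rw [AL_split hτ _ (τ / 2) (denA hτ hv)]
  generalize jacobiTheta₂ (v + τ / 2) τ = X
  generalize jacobiTheta₂ (v + 1 / 2) τ = Y
  generalize den τ (v + 1 / 2) 0 = Z
  simp only [div_eq_mul_inv, mul_inv]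
  ring

lemma Del_ext_tau {τ : ℂ} (hτ : 0 < τ.im) : PExt (Del τ) (τ / 2) := by
  obtain ⟨t0, t1, t2⟩ := theta_const_ne hτ
  have hone : jacobiTheta₂ (τ / 2 + τ / 2) τ = cexp (-(2 * Real.pi * I * (τ / 2))) * jacobiTheta₂ 0 τ := by
    rw [show (τ / 2 + τ / 2 : ℂ) = 0 + τ by ring, jacobiTheta₂_add_left']
    congr 2; ring
  have hE := exp_ne_zero (-(2 * Real.pi * I * (τ / 2)))
  have hA : jacobiTheta₂ (τ / 2 + τ / 2) τ ≠ 0 := by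
    rw [hone]; exact mul_ne_zero hE t0
  have a1 := AL0_an hτ (-(τ / 2)) (τ / 2) (1 / 2) (den_int_ne hτ _ (by simp))
  have a2 := AL_an hτ (1 / 2) (τ / 2) (τ / 2) (denA hτ hA)
  have he : cexp (2 * Real.pi * I * (τ / 2 + -(τ / 2))) = 1 := by simp
  have a6 : AnalyticAt ℂ (fun v => cexp (-(2 * Real.pi * I * v))) (τ / 2) := by fun_prop
  have hd := theta_deriv hτ
  rw [add_comm (1 / 2 : ℂ)] at hd
  have hd2 : HasDerivAt (fun v => jacobiTheta₂ (v + 1 / 2) τ) _ (τ / 2) := hd.comp_add_const _ _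
  have hpi : (Real.pi : ℂ) * I ≠ 0 := mul_ne_zero (by exact_mod_cast Real.pi_ne_zero) I_ne_zero
  have key := simple_pole_cancel (a := τ / 2) (f₁ := fun v => den τ (v + -(τ / 2)) 0)
    (f₂ := fun v => jacobiTheta₂ (v + 1 / 2) τ) (h₁ := fun _ => 1 / jacobiTheta₂ (1 / 2) τ)
    (h₂ := fun v => cexp (-(2 * Real.pi * I * v)) * jacobiTheta₂ 0 τ ^ 2 * jacobiTheta₂ v τ /
      (2 * jacobiTheta₂ (v + τ / 2) τ))
    (by
      have : Differentiable ℂ (fun v => den τ (v + -(τ / 2)) 0) :=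
        (den_differentiable τ 0).comp (differentiable_id.add_const _)
      exact this.analyticAt _)
    (J_an hτ _ _) analyticAt_const
    (((a6.mul analyticAt_const).mul (J_an' hτ _)).div (analyticAt_const.mul (J_an hτ _ _))
      (mul_ne_zero two_ne_zero hA))
    (by simp only [den, Int.cast_zero, zero_mul, add_zero]; rw [he, sub_self])
    (by
      have := (theta_zero_iff hτ 0).mpr ⟨0, by simp⟩
      rw [add_comm (τ / 2)]
      simpa using this)
    (den_hasDeriv τ _ _ he) hd2 (by rw [neg_ne_zero, mul_assoc]; exact mul_ne_zero two_ne_zero hpi)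
    (mul_ne_zero hpi (mul_ne_zero (mul_ne_zero t0 t1) t2))
    (by
      simp only [hone]
      generalize cexp (-(2 * Real.pi * I * (τ / 2))) = E at *
      field_simp
      ring)
  refine (key.an_add ((a1.div analyticAt_const t1).sub (a2.div analyticAt_const t2))).congr ?_
  filter_upwards [J_ne hτ (1 / 2) (τ / 2)] with v hv
  simp only [Del, Pi.sub_apply, Pi.div_apply]
  rw [AL_split hτ _ (1 / 2) (denB hτ hv)]
  generalize jacobiTheta₂ (v + τ / 2) τ = X
  generalize jacobiTheta₂ (v + 1 / 2) τ = Y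
  generalize den τ (v + -(τ / 2)) 0 = Z
  simp only [div_eq_mul_inv, mul_inv]
  ring

lemma Del_zero {τ : ℂ} (hτ : 0 < τ.im) {ρ : ℂ} (hA : jacobiTheta₂ (ρ + τ / 2) τ ≠ 0)
    (hB : jacobiTheta₂ (ρ + 1 / 2) τ ≠ 0) : Del τ ρ = 0 := by
  have h1 : ∀ x, ∀ᶠ y in 𝓝[≠] x, PP τ (y + 1) = -PP τ y := fun x =>
    Eventually.of_forall fun y => PP_add_one τ y
  have h2 : ∀ x, ∀ᶠ y in 𝓝[≠] x, PP τ (y + τ) = -PP τ y := fun x => by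
    filter_upwards [J_ne hτ (τ / 2) x, J_ne hτ (1 / 2) x] with y a b using PP_add_tau hτ a b
  have hext : ∀ x, PExt (PP τ) x := by
    intro x
    by_cases hA : jacobiTheta₂ (x + τ / 2) τ = 0
    · obtain ⟨m, n, rfl⟩ := badA hτ hA
      exact ((PP_ext_of_Del hτ (Del_ext_half hτ)).add_int h1 m).add_int h2 n
    by_cases hB : jacobiTheta₂ (x + 1 / 2) τ = 0
    · obtain ⟨m, n, rfl⟩ := badB hτ hB
      exact ((PP_ext_of_Del hτ (Del_ext_tau hτ)).add_int h1 m).add_int h2 n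
    exact PP_ext_of_Del hτ (PExt.of_an (Del_an hτ hA hB))
  have hz := ext_zero hτ hext h1 h2 ρ
  have hD : ∀ᶠ y in 𝓝[≠] ρ, Del τ y = 0 := by
    filter_upwards [hz, J_ne hτ 0 ρ] with y a b
    rw [add_zero] at b
    rw [PP] at a
    exact (mul_eq_zero.mp a).resolve_left (mul_ne_zero (exp_ne_zero _) b)
  have t1 : Tendsto (Del τ) (𝓝[≠] ρ) (𝓝 (Del τ ρ)) :=
    ((Del_an hτ hA hB).continuousAt.tendsto).mono_left nhdsWithin_le_nhds
  exact tendsto_nhds_unique t1 (tendsto_const_nhds.congr' (hD.mono fun z hz => hz.symm))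

lemma neg_one_zpow_exp (n : ℤ) : (-1 : ℂ) ^ n = cexp (Real.pi * I * n) := by
  rw [← exp_pi_mul_I, ← exp_int_mul]; congr 1; ring

lemma theta3e_eq (τ v : ℂ) : theta3e τ v = jacobiTheta₂ v τ := by
  rw [theta3e, jacobiTheta₂]
  congr 1; ext n
  rw [qp, jacobiTheta₂_term, ← exp_add]
  congr 1; ring

lemma theta4e_eq (τ v : ℂ) : theta4e τ v = jacobiTheta₂ (v + 1 / 2) τ := by
  rw [theta4e, jacobiTheta₂]
  congr 1; ext n
  rw [qp, jacobiTheta₂_term, neg_one_zpow_exp, ← exp_add, ← exp_add]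
  congr 1; ring

lemma theta2e_eq (τ v : ℂ) :
    theta2e τ v = qp τ (1 / 8) * cexp (Real.pi * I * v) * jacobiTheta₂ (v + τ / 2) τ := by
  rw [theta2e, jacobiTheta₂, ← tsum_mul_left]
  congr 1; ext n
  rw [qp, qp, jacobiTheta₂_term, ← exp_add, ← exp_add, ← exp_add]
  congr 1; ring

lemma Fe_eq (τ ρ : ℂ) : Fe τ ρ = -(cexp (Real.pi * I * ρ) / jacobiTheta₂ (1 / 2) τ) *
    (qp τ (-1 / 8) * AL τ (ρ + -(τ / 2)) (1 / 2)) := by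
  rw [Fe, theta4, theta4e_eq, zero_add, AL, ← tsum_mul_left (a := qp τ (-1 / 8))]
  congr 1
  refine tsum_congr fun n => ?_
  rw [← mul_div_assoc]
  congr 1
  · rw [qp, qp, jacobiTheta₂_term, neg_one_zpow_exp, ← exp_add, ← exp_add]
    congr 1; ring
  · rw [den, qp, ← exp_add]
    congr 2; ring

lemma FD_eq (τ ρ : ℂ) : FD τ ρ = -(cexp (Real.pi * I * ρ) / (qp τ (1 / 8) * jacobiTheta₂ (τ / 2) τ)) *
    AL τ (ρ + 1 / 2) (τ / 2) := by
  rw [FD, theta2, theta2e_eq, zero_add, AL, mul_zero, exp_zero, mul_one]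
  congr 1
  refine tsum_congr fun n => ?_
  congr 1
  · rw [qp, jacobiTheta₂_term]
    congr 1; ring
  · rw [den, qp, ← exp_add, show 2 * Real.pi * I * (ρ + 1 / 2 + n * τ) =
      2 * Real.pi * I * ρ + 2 * Real.pi * I * τ * n + Real.pi * I by ring, exp_pi_add]
    ring


/-- For every `τ ∈ ℍ`, wherever everything is defined,
`F(τ,ρ) − F_D(τ,ρ) = θ₃(τ)² θ₃(τ,ρ)/(2 θ₂(τ,ρ) θ₄(τ,ρ))`. -/
theorem F_sub_FD (τ ρ : ℂ) (hτ : 0 < τ.im)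
    (h1 : ∀ n : ℤ,
      1 - Complex.exp (2 * (Real.pi : ℂ) * Complex.I * ρ) * qp τ ((n : ℂ) - 1 / 2) ≠ 0)
    (h2 : ∀ n : ℤ,
      1 + Complex.exp (2 * (Real.pi : ℂ) * Complex.I * ρ) * qp τ (n : ℂ) ≠ 0)
    (h3 : theta2e τ ρ ≠ 0) (h4 : theta4e τ ρ ≠ 0) :
    Fe τ ρ - FD τ ρ = theta3 τ ^ 2 * theta3e τ ρ / (2 * theta2e τ ρ * theta4e τ ρ) := by
  obtain ⟨t0, t1, t2⟩ := theta_const_ne hτ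
  have hA : jacobiTheta₂ (ρ + τ / 2) τ ≠ 0 := by
    intro h; apply h3; rw [theta2e_eq, h, mul_zero]
  have hB : jacobiTheta₂ (ρ + 1 / 2) τ ≠ 0 := by rwa [← theta4e_eq]
  have hD := Del_zero hτ hA hB
  have q1 : qp τ (-1 / 8) = (qp τ (1 / 8))⁻¹ := by
    rw [qp, qp, ← exp_neg]; congr 1; ring
  have hq : qp τ (1 / 8) ≠ 0 := exp_ne_zero _
  have w1 : cexp (-(2 * Real.pi * I * ρ)) = (cexp (Real.pi * I * ρ) ^ 2)⁻¹ := by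
    rw [← exp_nat_mul, ← exp_neg]; congr 1; push_cast; ring
  have hw : cexp (Real.pi * I * ρ) ≠ 0 := exp_ne_zero _
  rw [Del, w1] at hD
  rw [Fe_eq, FD_eq, theta3, theta3e_eq, theta3e_eq, theta2e_eq, theta4e_eq, q1]
  generalize AL τ (ρ + -(τ / 2)) (1 / 2) = A1 at *
  generalize AL τ (ρ + 1 / 2) (τ / 2) = A2 at *
  generalize cexp (Real.pi * I * ρ) = w at *
  generalize qp τ (1 / 8) = Q at *
  generalize jacobiTheta₂ (ρ + τ / 2) τ = X at *
  generalize jacobiTheta₂ (ρ + 1 / 2) τ = Y at *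
  generalize jacobiTheta₂ (1 / 2) τ = T1 at *
  generalize jacobiTheta₂ (τ / 2) τ = T2 at *
  have e : -(w / T1) * (Q⁻¹ * A1) - -(w / (Q * T2)) * A2 =
      -(w / Q) * (A1 / T1 - A2 / T2) := by field_simp; ring
  have hD' : A1 / T1 - A2 / T2 =
      -((w ^ 2)⁻¹ * jacobiTheta₂ 0 τ ^ 2 * jacobiTheta₂ ρ τ / (2 * X * Y)) := by
    linear_combination hD
  rw [e, hD']
  field_simp
end
end

section
/- For every τ ∈ ℍ, the function F(τ,ρ) = −(w^{1/2}/θ₄(τ)) ∑_{n∈ℤ} (−1)ⁿ q^{n²/2 − 1/8}/(1 − w q^{n−1/2}), w = e^{2πiρ}, satisfies the quasi-periodicity and symmetry relations F(τ,ρ+1) = −F(τ,ρ), F(τ,−ρ) = F(τ,ρ), and F(τ,ρ+τ) = −e^{πiτ} e^{2πiρ} F(τ,ρ) − e^{(3/4)πiτ} e^{πiρ}, as identities of meromorphic functions of ρ ∈ ℂ. -/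
open Complex

noncomputable section

lemma qp_add (τ a b : ℂ) : qp τ (a + b) = qp τ a * qp τ b := by
  unfold qp
  rw [← Complex.exp_add]
  congr 1
  ring

lemma qp_ne (τ a : ℂ) : qp τ a ≠ 0 := Complex.exp_ne_zero _

lemma neg_one_zpow_eq (n : ℤ) : (-1 : ℂ) ^ n = Complex.exp (Real.pi * Complex.I * n ^ 2) := by
  have h : (-1 : ℂ) ^ n = (-1 : ℂ) ^ (n ^ 2) := by
    rcases Int.even_or_odd n with h | h
    · rw [h.neg_one_zpow, Even.neg_one_zpow]
      exact h.pow_of_ne_zero (by norm_num)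
    · rw [h.neg_one_zpow, Odd.neg_one_zpow]
      exact h.pow
  rw [h, ← Complex.exp_pi_mul_I, ← Complex.exp_int_mul]
  congr 1
  push_cast
  ring

/-- The general term of `θ₄`. -/
def tt (τ : ℂ) (n : ℤ) : ℂ := (-1 : ℂ) ^ n * qp τ ((n : ℂ) ^ 2 / 2)

lemma tt_eq (τ : ℂ) (n : ℤ) :
    tt τ n = Complex.exp (Real.pi * Complex.I * (n : ℂ) ^ 2 * (τ + 1)) := by
  rw [tt, neg_one_zpow_eq, qp, ← Complex.exp_add]
  congr 1
  ring

lemma theta4_eq_tsum (τ : ℂ) : theta4 τ = ∑' n : ℤ, tt τ n := by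
  simp [theta4, theta4e, tt]

lemma theta4_eq (τ : ℂ) : theta4 τ = jacobiTheta (τ + 1) := by
  rw [theta4_eq_tsum, jacobiTheta]
  exact tsum_congr (tt_eq τ)

lemma summable_tt {τ : ℂ} (hτ : 0 < τ.im) : Summable (tt τ) := by
  have h := (summable_jacobiTheta₂_term_iff 0 (τ + 1)).2 (by simpa using hτ)
  refine h.congr fun n => ?_
  rw [tt_eq, jacobiTheta₂_term]
  congr 1
  ring

lemma norm_tt (τ : ℂ) (n : ℤ) : ‖tt τ n‖ = ‖qp τ ((n : ℂ) ^ 2 / 2)‖ := by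
  rw [tt, norm_mul, norm_zpow]
  simp

lemma theta34 {τ : ℂ} (hτ : 0 < τ.im) :
    (∑' n : ℤ, qp τ ((n : ℂ) ^ 2 / 2)) * theta4 τ = theta4 (2 * τ) ^ 2 := by
  have hτ2 : 0 < (2 * τ).im := by simpa using hτ
  have s4 := (summable_tt hτ).norm
  have s42 := (summable_tt hτ2).norm
  have s3 : Summable fun n : ℤ => ‖qp τ ((n : ℂ) ^ 2 / 2)‖ := by
    simpa only [norm_tt] using s4
  have sH := summable_mul_of_summable_norm s3 s4
  have sH' : Summable fun z : ℤ × ℤ => qp τ ((z.2 : ℂ) ^ 2 / 2) * tt τ z.1 :=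
    (Equiv.prodComm ℤ ℤ).summable_iff.2 sH
  have eH' : ∑' z : ℤ × ℤ, qp τ ((z.2 : ℂ) ^ 2 / 2) * tt τ z.1
      = ∑' z : ℤ × ℤ, qp τ ((z.1 : ℂ) ^ 2 / 2) * tt τ z.2 :=
    (Equiv.prodComm ℤ ℤ).tsum_eq (fun z : ℤ × ℤ => qp τ ((z.1 : ℂ) ^ 2 / 2) * tt τ z.2)
  have e2 := Summable.tsum_add sH sH'
  rw [eH', ← tsum_mul_tsum_of_summable_norm s3 s4] at e2
  let φ : ℤ × ℤ → ℤ × ℤ := fun z => (z.1 + z.2, z.1 - z.2)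
  have hφ : Function.Injective φ := by
    rintro ⟨a, b⟩ ⟨c, d⟩ h
    simp only [φ, Prod.mk.injEq] at h ⊢
    omega
  rw [← hφ.tsum_eq] at e2
  · have key : ∀ z : ℤ × ℤ, qp τ (((φ z).1 : ℂ) ^ 2 / 2) * tt τ (φ z).2
        + qp τ (((φ z).2 : ℂ) ^ 2 / 2) * tt τ (φ z).1
        = 2 * (tt (2 * τ) z.1 * tt (2 * τ) z.2) := by
      rintro ⟨a, b⟩
      have h1 : (-1 : ℂ) ^ (a + b) = (-1) ^ a * (-1) ^ b := zpow_add₀ (by norm_num) _ _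
      have h2 : (-1 : ℂ) ^ (a - b) = (-1) ^ a * (-1) ^ b := by
        rw [← h1, show a - b = a + b - 2 * b by ring, zpow_sub₀ (by norm_num), zpow_mul]
        simp
      have h3 : qp τ (((a + b : ℤ) : ℂ) ^ 2 / 2) * qp τ (((a - b : ℤ) : ℂ) ^ 2 / 2)
          = qp (2 * τ) ((a : ℂ) ^ 2 / 2) * qp (2 * τ) ((b : ℂ) ^ 2 / 2) := by
        simp only [qp]
        rw [← Complex.exp_add, ← Complex.exp_add]
        congr 1
        push_cast
        ring
      simp only [φ, tt, h1, h2]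
      linear_combination 2 * (-1 : ℂ) ^ a * (-1) ^ b * h3
    simp only [key] at e2
    rw [tsum_mul_left, ← tsum_mul_tsum_of_summable_norm s42 s42, ← theta4_eq_tsum,
      ← theta4_eq_tsum] at e2
    linear_combination -(1 / 2) * e2
  · rintro ⟨m, n⟩ h
    rw [Function.mem_support] at h
    by_cases hp : Even (m + n)
    · obtain ⟨k, hk⟩ := hp
      refine ⟨(k, m - k), ?_⟩
      simp only [φ, Prod.mk.injEq]
      omega
    · exfalso
      apply h
      have : (-1 : ℂ) ^ m + (-1) ^ n = 0 := by
        rcases Int.even_or_odd m with hm | hm <;> rcases Int.even_or_odd n with hn | hn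
        · exact absurd (hm.add hn) hp
        · rw [hm.neg_one_zpow, hn.neg_one_zpow]; norm_num
        · rw [hm.neg_one_zpow, hn.neg_one_zpow]; norm_num
        · exact absurd (hm.add_odd hn) hp
      simp only [tt]
      linear_combination qp τ ((m : ℂ) ^ 2 / 2) * qp τ ((n : ℂ) ^ 2 / 2) * this

lemma theta4_ne_of_one_le {τ : ℂ} (hτ : 1 ≤ τ.im) : theta4 τ ≠ 0 := by
  intro h0
  have h := norm_jacobiTheta_sub_one_le (τ := τ + 1) (by simp; linarith)
  rw [← theta4_eq, h0] at h
  set y := Real.exp (-Real.pi * (τ + 1).im) with hy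
  have hy3 : y < 1 / 3 := by
    have : Real.exp (-Real.pi * (τ + 1).im) = (Real.exp (Real.pi * τ.im))⁻¹ := by
      rw [← Real.exp_neg]; simp
    rw [hy, this, one_div]
    apply inv_strictAnti₀ (by norm_num)
    have h3 := Real.pi_gt_three
    have := Real.add_one_le_exp (Real.pi * τ.im)
    nlinarith
  have : (2 / (1 - y)) * y < 1 := by
    rw [div_mul_eq_mul_div, div_lt_one (by linarith)]
    linarith
  simp at h
  linarith

lemma theta4_ne {τ : ℂ} (hτ : 0 < τ.im) : theta4 τ ≠ 0 := by
  intro h0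
  have hn : ∀ k : ℕ, theta4 (2 ^ k * τ) = 0 ∧ (2 ^ k * τ).im = 2 ^ k * τ.im := by
    intro k
    induction k with
    | zero => simpa using h0
    | succ k ih =>
      have hp : 0 < (2 ^ k * τ).im := by rw [ih.2]; positivity
      have e : (2 : ℂ) ^ (k + 1) * τ = 2 * (2 ^ k * τ) := by ring
      rw [e]
      constructor
      · have := theta34 hp
        rw [ih.1, mul_zero] at this
        exact pow_eq_zero_iff (by norm_num) |>.1 this.symm
      · have : (2 * (2 ^ k * τ)).im = 2 * (2 ^ k * τ).im := by simp
        rw [this, ih.2]; ring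
  obtain ⟨k, hk⟩ := pow_unbounded_of_one_lt (1 / τ.im) (one_lt_two)
  refine theta4_ne_of_one_le (τ := 2 ^ k * τ) ?_ (hn k).1
  rw [(hn k).2]
  rw [div_lt_iff₀ hτ] at hk
  exact hk.le

lemma norm_qp (τ : ℂ) (n : ℤ) :
    ‖qp τ ((n : ℂ) - 1 / 2)‖ = Real.exp (2 * Real.pi * τ.im * (1 / 2 - n)) := by
  rw [qp, Complex.norm_exp]
  congr 1
  have : 2 * (Real.pi : ℂ) * Complex.I * τ * ((n : ℂ) - 1 / 2)
    = ((2 * Real.pi * ((n : ℝ) - 1 / 2) : ℝ) : ℂ) * (τ * Complex.I) := by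
    push_cast; ring
  rw [this, Complex.re_ofReal_mul, Complex.mul_I_re]
  ring

open Filter in
lemma denom_bound {τ : ℂ} (hτ : 0 < τ.im) (w : ℂ) (hw : w ≠ 0) :
    ∀ᶠ n : ℤ in cofinite, 1 / 2 ≤ ‖1 - w * qp τ ((n : ℂ) - 1 / 2)‖ := by
  have hw' : 0 < ‖w‖ := norm_pos_iff.2 hw
  have hc : 0 < 2 * Real.pi * τ.im := by have := Real.pi_pos; positivity
  rw [Int.cofinite_eq, eventually_sup]
  constructor
  · have t : Tendsto (fun n : ℤ => ‖w‖ * Real.exp (2 * Real.pi * τ.im * (1 / 2 - n)))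
        atBot atTop := by
      refine Tendsto.const_mul_atTop hw' (Real.tendsto_exp_atTop.comp ?_)
      refine Tendsto.const_mul_atTop hc ?_
      simp only [sub_eq_add_neg]
      refine tendsto_atTop_add_const_left _ _ (tendsto_neg_atBot_atTop.comp ?_)
      exact tendsto_intCast_atBot_iff.2 tendsto_id
    filter_upwards [t.eventually_ge_atTop 2] with n hn
    rw [← norm_qp, ← norm_mul] at hn
    have := norm_sub_norm_le (w * qp τ ((n : ℂ) - 1 / 2)) 1
    rw [norm_sub_rev, norm_one] at this
    linarith
  · have t : Tendsto (fun n : ℤ => ‖w‖ * Real.exp (2 * Real.pi * τ.im * (1 / 2 - n)))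
        atTop (nhds (‖w‖ * 0)) := by
      refine Tendsto.const_mul _ (Real.tendsto_exp_atBot.comp ?_)
      refine Tendsto.const_mul_atBot hc ?_
      simp only [sub_eq_add_neg]
      refine tendsto_atBot_add_const_left _ _ (tendsto_neg_atTop_atBot.comp ?_)
      exact tendsto_intCast_atTop_atTop
    rw [mul_zero] at t
    filter_upwards [t.eventually_le_const (show (0 : ℝ) < 1 / 2 by norm_num)] with n hn
    rw [← norm_qp, ← norm_mul] at hn
    have := norm_sub_norm_le 1 (w * qp τ ((n : ℂ) - 1 / 2))
    rw [norm_one] at this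
    linarith

/-- Numerators. -/
def AA (τ : ℂ) (n : ℤ) : ℂ := (-1 : ℂ) ^ n * qp τ ((n : ℂ) ^ 2 / 2 - 1 / 8)

lemma AA_eq (τ : ℂ) (n : ℤ) : AA τ n = qp τ (-1 / 8) * tt τ n := by
  rw [AA, tt, show (n : ℂ) ^ 2 / 2 - 1 / 8 = -1 / 8 + (n : ℂ) ^ 2 / 2 by ring, qp_add]
  ring

lemma AA_shift (τ : ℂ) (n : ℤ) :
    AA τ (n - 1) * qp τ ((n : ℂ) - 1 / 2) = - AA τ n := by
  have h : (-1 : ℂ) ^ (n - 1) = -(-1) ^ n := by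
    rw [zpow_sub_one₀ (by norm_num)]; norm_num
  rw [AA, AA, h, mul_assoc, ← qp_add]
  have : ((n - 1 : ℤ) : ℂ) ^ 2 / 2 - 1 / 8 + ((n : ℂ) - 1 / 2) = (n : ℂ) ^ 2 / 2 - 1 / 8 := by
    push_cast; ring
  rw [this]
  ring

lemma AA_refl (τ : ℂ) (n : ℤ) : AA τ (1 - n) = AA τ (n - 1) := by
  have h : (-1 : ℂ) ^ (1 - n) = (-1) ^ (n - 1) := by
    rw [← neg_sub, zpow_neg, ← inv_zpow]; norm_num
  rw [AA, AA, h]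
  congr 2
  push_cast
  ring

lemma summable_AA {τ : ℂ} (hτ : 0 < τ.im) : Summable (AA τ) :=
  ((summable_tt hτ).mul_left (qp τ (-1 / 8))).congr fun n => (AA_eq τ n).symm

lemma summable_S {τ : ℂ} (hτ : 0 < τ.im) (w : ℂ) (hw : w ≠ 0) :
    Summable fun n : ℤ => AA τ n / (1 - w * qp τ ((n : ℂ) - 1 / 2)) := by
  refine Summable.of_norm_bounded_eventually ((summable_AA hτ).norm.mul_left 2) ?_
  filter_upwards [denom_bound hτ w hw] with n hn
  rw [norm_div, div_le_iff₀ (by linarith)]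
  nlinarith [norm_nonneg (AA τ n)]

lemma Fe_eq_s13 (τ ρ : ℂ) : Fe τ ρ = -(Complex.exp ((Real.pi : ℂ) * Complex.I * ρ) / theta4 τ) *
    ∑' n : ℤ, AA τ n /
      (1 - Complex.exp (2 * (Real.pi : ℂ) * Complex.I * ρ) * qp τ ((n : ℂ) - 1 / 2)) := rfl

/-- Quasi-periodicity and symmetry of `F`: for every `τ ∈ ℍ`, wherever the series is
defined, `F(τ,ρ+1) = −F(τ,ρ)`, `F(τ,−ρ) = F(τ,ρ)`, and
`F(τ,ρ+τ) = −e^{πiτ} e^{2πiρ} F(τ,ρ) − e^{(3/4)πiτ} e^{πiρ}`. -/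
theorem F_quasiperiodic (τ ρ : ℂ) (hτ : 0 < τ.im)
    (h1 : ∀ n : ℤ,
      1 - Complex.exp (2 * (Real.pi : ℂ) * Complex.I * ρ) * qp τ ((n : ℂ) - 1 / 2) ≠ 0) :
    Fe τ (ρ + 1) = -Fe τ ρ ∧
    Fe τ (-ρ) = Fe τ ρ ∧
    Fe τ (ρ + τ) =
      -Complex.exp ((Real.pi : ℂ) * Complex.I * τ) *
          Complex.exp (2 * (Real.pi : ℂ) * Complex.I * ρ) * Fe τ ρ
        - Complex.exp ((3 / 4 : ℂ) * (Real.pi : ℂ) * Complex.I * τ) *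
            Complex.exp ((Real.pi : ℂ) * Complex.I * ρ) := by
  refine ⟨?_, ?_, ?_⟩
  · have e1 : Complex.exp (2 * (Real.pi : ℂ) * Complex.I * (ρ + 1))
        = Complex.exp (2 * (Real.pi : ℂ) * Complex.I * ρ) := by
      rw [mul_add, Complex.exp_add, mul_one, Complex.exp_two_pi_mul_I, mul_one]
    have e2 : Complex.exp ((Real.pi : ℂ) * Complex.I * (ρ + 1))
        = - Complex.exp ((Real.pi : ℂ) * Complex.I * ρ) := by
      rw [mul_add, Complex.exp_add, mul_one, Complex.exp_pi_mul_I, mul_neg, mul_one]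
    rw [Fe_eq_s13, Fe_eq_s13, e1, e2]
    ring
  · have e1 : Complex.exp (2 * (Real.pi : ℂ) * Complex.I * (-ρ))
        = (Complex.exp (2 * (Real.pi : ℂ) * Complex.I * ρ))⁻¹ := by
      rw [mul_neg, Complex.exp_neg]
    have e2 : Complex.exp ((Real.pi : ℂ) * Complex.I * (-ρ))
        * Complex.exp (2 * (Real.pi : ℂ) * Complex.I * ρ)
        = Complex.exp ((Real.pi : ℂ) * Complex.I * ρ) := by
      rw [← Complex.exp_add]; congr 1; ring
    rw [Fe_eq_s13, Fe_eq_s13, e1, ← e2]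
    have hw := Complex.exp_ne_zero (2 * (Real.pi : ℂ) * Complex.I * ρ)
    generalize Complex.exp (2 * (Real.pi : ℂ) * Complex.I * ρ) = w at *
    rw [← (Equiv.subLeft (1 : ℤ)).tsum_eq
      (fun n : ℤ => AA τ n / (1 - w⁻¹ * qp τ ((n : ℂ) - 1 / 2)))]
    have key : ∀ n : ℤ, AA τ (1 - n) / (1 - w⁻¹ * qp τ (((1 - n : ℤ) : ℂ) - 1 / 2))
        = w * (AA τ n / (1 - w * qp τ ((n : ℂ) - 1 / 2))) := by
      intro n
      have hs := AA_shift τ n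
      have hx : qp τ (((1 - n : ℤ) : ℂ) - 1 / 2) * qp τ ((n : ℂ) - 1 / 2) = 1 := by
        rw [← qp_add]
        push_cast
        rw [show (1 : ℂ) - n - 1 / 2 + (n - 1 / 2) = 0 by ring, qp]
        simp
      have hx0 := qp_ne τ ((n : ℂ) - 1 / 2)
      have hd := h1 n
      rw [AA_refl, eq_inv_of_mul_eq_one_left hx]
      generalize qp τ ((n : ℂ) - 1 / 2) = x at *
      have hd' : 1 - w⁻¹ * x⁻¹ ≠ 0 := by
        intro h
        apply hd
        field_simp at h
        linear_combination -h
      rw [← mul_div_assoc, div_eq_div_iff hd' hd]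
      have : AA τ n = -(AA τ (n - 1) * x) := by rw [hs, neg_neg]
      rw [this]
      field_simp
      ring
    simp only [Equiv.subLeft_apply, key]
    rw [tsum_mul_left]
    ring
  · have hθ := theta4_ne hτ
    have e1 : Complex.exp (2 * (Real.pi : ℂ) * Complex.I * (ρ + τ))
        = Complex.exp (2 * (Real.pi : ℂ) * Complex.I * ρ) * qp τ 1 := by
      rw [qp, ← Complex.exp_add]; congr 1; ring
    have e2 : Complex.exp ((Real.pi : ℂ) * Complex.I * (ρ + τ))
        = Complex.exp ((Real.pi : ℂ) * Complex.I * ρ)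
          * Complex.exp ((Real.pi : ℂ) * Complex.I * τ) := by
      rw [← Complex.exp_add]; congr 1; ring
    have e3 : Complex.exp ((3 / 4 : ℂ) * (Real.pi : ℂ) * Complex.I * τ)
        = Complex.exp ((Real.pi : ℂ) * Complex.I * τ) * qp τ (-1 / 8) := by
      rw [qp, ← Complex.exp_add]; congr 1; ring
    rw [Fe_eq_s13, Fe_eq_s13, e1, e2, e3]
    have hw := Complex.exp_ne_zero (2 * (Real.pi : ℂ) * Complex.I * ρ)
    generalize Complex.exp (2 * (Real.pi : ℂ) * Complex.I * ρ) = w at *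
    have hS := summable_S hτ w hw
    have hA : Summable fun n : ℤ => AA τ (n - 1) :=
      (Equiv.subRight (1 : ℤ)).summable_iff.2 (summable_AA hτ)
    have hA' : ∑' n : ℤ, AA τ (n - 1) = qp τ (-1 / 8) * theta4 τ := by
      refine ((Equiv.subRight (1 : ℤ)).tsum_eq (AA τ)).trans ?_
      rw [theta4_eq_tsum, ← tsum_mul_left]
      exact tsum_congr (AA_eq τ)
    rw [← (Equiv.subRight (1 : ℤ)).tsum_eq
      (fun n : ℤ => AA τ n / (1 - w * qp τ 1 * qp τ ((n : ℂ) - 1 / 2)))]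
    have key : ∀ n : ℤ, AA τ (n - 1) / (1 - w * qp τ 1 * qp τ (((n - 1 : ℤ) : ℂ) - 1 / 2))
        = AA τ (n - 1) - w * (AA τ n / (1 - w * qp τ ((n : ℂ) - 1 / 2))) := by
      intro n
      have hs := AA_shift τ n
      have hd := h1 n
      rw [mul_assoc w, ← qp_add, show (1 : ℂ) + (((n - 1 : ℤ) : ℂ) - 1 / 2) = n - 1 / 2 by
        push_cast; ring]
      generalize qp τ ((n : ℂ) - 1 / 2) = x at *
      rw [← mul_div_assoc, eq_sub_iff_add_eq, ← add_div, div_eq_iff hd]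
      linear_combination w * hs
    simp only [Equiv.subRight_apply, key]
    rw [hA.tsum_sub (hS.mul_left w), hA', tsum_mul_left]
    field_simp
    ring
end
end
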